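/- Let N ≥ 2 and 1 < α < N. There exists 0 < ε₁ ≪ 1 depending only on N and α with the following property. Let 0 < ε < ε₁, let E' ⊆ ℝ^N be a measurable set of measure ω_N, let z ∈ ℝ^N, and assume B_z(1−ε) ⊆ E' ⊆ B_z(1+ε). Then either there is a constant C depending only on N and α such that δ(E') ≤ C·√(D(E')), or there exists a set E_z which is ε-nearly spherical around B_z and satisfies D(E_z) ≤ 2·D(E') and |E_z Δ B_z| ≥ δ(E')/6. -/

import Mathlib

open MeasureTheory Metric
open scoped symmDiff

noncomputable def rieszEnergy (N : ℕ) (α : ℝ) (E : Set (EuclideanSpace ℝ (Fin N))) : ℝ :=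
  ∫ x in E, ∫ y in E, ‖y - x‖ ^ (α - (N : ℝ))

noncomputable def deficit (N : ℕ) (α : ℝ) (E : Set (EuclideanSpace ℝ (Fin N))) : ℝ :=
  rieszEnergy N α (ball (0 : EuclideanSpace ℝ (Fin N)) 1) - rieszEnergy N α E

noncomputable def asymmetry (N : ℕ) (E : Set (EuclideanSpace ℝ (Fin N))) : ℝ :=
  ⨅ x : EuclideanSpace ℝ (Fin N), (volume (ball x 1 ∆ E)).toReal

/-- `S` is an `ε`-nearly spherical set around the unit ball centered at `z`:
its boundary is the graph over `∂B` of a measurable function `u` with values in `(-ε, ε)`. -/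
def IsNearlySpherical (N : ℕ) (ε : ℝ) (z : EuclideanSpace ℝ (Fin N))
    (S : Set (EuclideanSpace ℝ (Fin N))) : Prop :=
  volume S = volume (ball (0 : EuclideanSpace ℝ (Fin N)) 1) ∧
  ∃ u : EuclideanSpace ℝ (Fin N) → ℝ, Measurable u ∧
    (∀ x ∈ sphere (0 : EuclideanSpace ℝ (Fin N)) 1, u x ∈ Set.Ioo (-ε) ε) ∧
    S = {p | ∃ x ∈ sphere (0 : EuclideanSpace ℝ (Fin N)) 1,
          ∃ ρ : ℝ, -1 ≤ ρ ∧ ρ ≤ u x ∧ p = z + (1 + ρ) • x}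

open scoped ENNReal NNReal

namespace RieszStability

variable {N : ℕ} {p : ℝ}

/-- The Euclidean space of dimension `N`. -/
abbrev Euc (N : ℕ) := EuclideanSpace ℝ (Fin N)

/-- The Riesz potential of `A` with kernel `‖y - x‖ ^ (-p)`. -/
noncomputable def pot {N : ℕ} (p : ℝ) (A : Set (Euc N)) (x : Euc N) : ℝ≥0∞ :=
  ∫⁻ y in A, ‖y - x‖ₑ ^ (-p)

/-- The extended Riesz energy of `A` with kernel `‖y - x‖ ^ (-p)`. -/
noncomputable def energy {N : ℕ} (p : ℝ) (A : Set (Euc N)) : ℝ≥0∞ :=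
  ∫⁻ x in A, pot p A x

/-- The mass of the kernel in the unit ball. -/
noncomputable def kernelMass (N : ℕ) (p : ℝ) : ℝ≥0∞ :=
  ∫⁻ y in ball (0 : Euc N) 1, ‖y‖ₑ ^ (-p)

lemma measurable_kernel (p : ℝ) :
    Measurable fun z : Euc N × Euc N => ‖z.2 - z.1‖ₑ ^ (-p) := by
  fun_prop

lemma measurable_pot (p : ℝ) (A : Set (Euc N)) : Measurable (pot p A) :=
  (measurable_kernel p).lintegral_prod_right'

lemma enorm_rpow_eq_ofReal {x : Euc N} (hx : x ≠ 0) (q : ℝ) :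
    ‖x‖ₑ ^ q = ENNReal.ofReal (‖x‖ ^ q) := by
  rw [← ofReal_norm, ENNReal.ofReal_rpow_of_pos (norm_pos_iff.2 hx)]

lemma ae_ne_point (hN : 1 ≤ N) (x : Euc N) : ∀ᵐ y : Euc N, y ≠ x := by
  have : Nonempty (Fin N) := ⟨⟨0, hN⟩⟩
  exact Measure.ae_ne volume x

lemma kernelMass_lt_top (hN : 1 ≤ N) (hpN : p < N) : kernelMass N p < ∞ := by
  have h : IntegrableOn (fun y : Euc N => ‖y‖ ^ (-p)) (ball 0 1) := by
    refine integrableOn_ball_of_norm_le_rpow (C := 1) (α := p) (by simpa) (by simpa) ?_ ?_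
    · exact .of_forall fun x => by simp [abs_of_nonneg (Real.rpow_nonneg (norm_nonneg x) (-p))]
    · exact Measurable.aestronglyMeasurable (by fun_prop)
  have h2 := h.2
  rw [hasFiniteIntegral_iff_ofReal (.of_forall fun x => by positivity)] at h2
  refine lt_of_eq_of_lt ?_ h2
  refine lintegral_congr_ae (ae_restrict_of_ae ?_)
  filter_upwards [ae_ne_point hN 0] with y hy
  exact enorm_rpow_eq_ofReal hy _

/-- The kernel is at most its truncation to the unit ball plus one. -/
lemma kernel_le_indicator_add_one (hp : 0 ≤ p) (y : Euc N) :
    ‖y‖ₑ ^ (-p) ≤ (ball (0 : Euc N) 1).indicator (fun y => ‖y‖ₑ ^ (-p)) y + 1 := by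
  by_cases hy : y ∈ ball (0 : Euc N) 1
  · simp [hy]
  · rw [Set.indicator_of_notMem hy, zero_add]
    have h1 : 1 ≤ ‖y‖ₑ := by
      rw [← ofReal_norm, ENNReal.one_le_ofReal]
      simpa using hy
    rw [ENNReal.rpow_neg, ENNReal.inv_le_one]
    simpa using ENNReal.rpow_le_rpow h1 hp

lemma pot_le_translate (hp : 0 ≤ p) (A : Set (Euc N)) (x : Euc N) :
    pot p A x ≤ (∫⁻ y in (fun y => y + x) ⁻¹' A,
      (ball (0 : Euc N) 1).indicator (fun y => ‖y‖ₑ ^ (-p)) y) + volume A := by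
  have h := (measurePreserving_add_right (volume : Measure (Euc N))
    x).setLIntegral_comp_preimage_emb
    (measurableEmbedding_addRight x)
    (fun y => (ball (0 : Euc N) 1).indicator (fun y => ‖y‖ₑ ^ (-p)) (y - x)) A
  simp only [add_sub_cancel_right] at h
  calc pot p A x ≤ ∫⁻ y in A,
        ((ball (0 : Euc N) 1).indicator (fun y => ‖y‖ₑ ^ (-p)) (y - x) + 1) :=
        lintegral_mono fun y => kernel_le_indicator_add_one hp _
    _ = _ := by
        rw [lintegral_add_right _ measurable_const, h]
        simp

lemma pot_le (hp : 0 ≤ p) (A : Set (Euc N)) (x : Euc N) :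
    pot p A x ≤ kernelMass N p + volume A := by
  refine (pot_le_translate hp A x).trans ?_
  gcongr
  rw [kernelMass, ← lintegral_indicator measurableSet_ball]
  exact setLIntegral_le_lintegral _ _

lemma pot_lt_top (hN : 1 ≤ N) (hp : 0 ≤ p) (hpN : p < N) {A : Set (Euc N)} (hA : volume A < ∞)
    (x : Euc N) : pot p A x < ∞ :=
  (pot_le hp A x).trans_lt (ENNReal.add_lt_top.2 ⟨kernelMass_lt_top hN hpN, hA⟩)

lemma energy_lt_top (hN : 1 ≤ N) (hp : 0 ≤ p) (hpN : p < N) {A : Set (Euc N)}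
    (hA : volume A < ∞) : energy p A < ∞ := by
  calc energy p A ≤ ∫⁻ _ in A, (kernelMass N p + volume A) := lintegral_mono fun x => pot_le hp A x
    _ = (kernelMass N p + volume A) * volume A := by simp
    _ < ∞ := ENNReal.mul_lt_top (ENNReal.add_lt_top.2 ⟨kernelMass_lt_top hN hpN, hA⟩) hA

/-- Potentials of sets of small measure are uniformly small. -/
lemma exists_pot_le_of_volume_lt (hN : 1 ≤ N) (hp : 0 ≤ p) (hpN : p < N) {η : ℝ≥0∞} (hη : η ≠ 0) :
    ∃ δ > 0, ∀ A : Set (Euc N), volume A < δ → ∀ x, pot p A x ≤ η := by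
  have hfin : ∫⁻ y : Euc N, (ball (0 : Euc N) 1).indicator (fun y => ‖y‖ₑ ^ (-p)) y ≠ ∞ := by
    rw [lintegral_indicator measurableSet_ball]
    exact (kernelMass_lt_top hN hpN).ne
  obtain ⟨δ, hδ, h⟩ := exists_pos_setLIntegral_lt_of_measure_lt hfin (ENNReal.half_pos hη).ne'
  refine ⟨min δ (η / 2), lt_min hδ (ENNReal.half_pos hη), fun A hA x => ?_⟩
  have hA' : volume ((fun y => y + x) ⁻¹' A) < δ := by
    rw [measure_preimage_add_right]
    exact hA.trans_le (min_le_left _ _)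
  calc pot p A x ≤ _ := pot_le_translate hp A x
    _ ≤ η / 2 + η / 2 := add_le_add (h _ hA').le (hA.le.trans (min_le_right _ _))
    _ = η := ENNReal.add_halves η

lemma integral_kernel_eq (hN : 1 ≤ N) (A : Set (Euc N)) (x : Euc N) :
    ∫ y in A, ‖y - x‖ ^ (-p) = (pot p A x).toReal := by
  rw [integral_eq_lintegral_of_nonneg_ae (.of_forall fun y => by positivity)
    (Measurable.aestronglyMeasurable (by fun_prop))]
  congr 1
  refine lintegral_congr_ae (ae_restrict_of_ae ?_)
  filter_upwards [ae_ne_point hN x] with y hy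
  exact (enorm_rpow_eq_ofReal (sub_ne_zero.2 hy) _).symm

lemma rieszEnergy_eq {α : ℝ} (hN : 1 ≤ N) (hα₀ : 0 < α) (hα : α ≤ N) {A : Set (Euc N)}
    (hA : volume A < ∞) : rieszEnergy N α A = (energy (N - α) A).toReal := by
  have : α - (N : ℝ) = -(N - α) := by ring
  simp only [rieszEnergy, this, integral_kernel_eq hN]
  refine integral_toReal (measurable_pot _ _).aemeasurable (.of_forall fun x => ?_)
  exact pot_lt_top hN (by linarith) (by linarith) hA x

lemma lintegral_pot_comm (p : ℝ) (A C : Set (Euc N)) :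
    ∫⁻ x in A, pot p C x = ∫⁻ x in C, pot p A x := by
  simp only [pot]
  rw [lintegral_lintegral_swap (measurable_kernel p).aemeasurable]
  refine lintegral_congr fun y => lintegral_congr fun x => ?_
  rw [← enorm_neg, neg_sub]

/-- The energy is Lipschitz with respect to the measure of the difference. -/
lemma energy_le_add (hp : 0 ≤ p) (A C : Set (Euc N)) :
    energy p A ≤ energy p C +
      ((kernelMass N p + volume A) + (kernelMass N p + volume C)) * volume (A \ C) := by
  have key : ∀ D : Set (Euc N), ∫⁻ x in A, pot p D x ≤
      (∫⁻ x in C, pot p D x) + (kernelMass N p + volume D) * volume (A \ C) := fun D => by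
    calc ∫⁻ x in A, pot p D x ≤ ∫⁻ x in C ∪ A \ C, pot p D x :=
          lintegral_mono_set (by simp)
      _ ≤ (∫⁻ x in C, pot p D x) + ∫⁻ x in A \ C, pot p D x := lintegral_union_le _ _ _
      _ ≤ (∫⁻ x in C, pot p D x) + ∫⁻ x in A \ C, (kernelMass N p + volume D) := by
          gcongr with x
          exact pot_le hp D x
      _ = _ := by simp
  calc energy p A ≤ (∫⁻ x in C, pot p A x) + (kernelMass N p + volume A) * volume (A \ C) := key A
    _ = (∫⁻ x in A, pot p C x) + (kernelMass N p + volume A) * volume (A \ C) := by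
        rw [lintegral_pot_comm]
    _ ≤ (energy p C + (kernelMass N p + volume C) * volume (A \ C)) +
        (kernelMass N p + volume A) * volume (A \ C) := by
        gcongr
        exact key C
    _ = _ := by ring

/-- The reflection across the hyperplane through `b` orthogonal to `b`. -/
noncomputable def mirror (b y : Euc N) : Euc N :=
  y + (2 * (1 - inner ℝ b y / ‖b‖ ^ 2)) • b

/-- An affine function that is positive on the side of the mirror containing the origin. -/
noncomputable def side (b y : Euc N) : ℝ := ‖b‖ ^ 2 - inner ℝ b y

lemma mirror_eq_reflection (b y : Euc N) :
    mirror b y = Submodule.reflection (ℝ ∙ b)ᗮ y + (2 : ℝ) • b := by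
  rw [mirror, Submodule.reflection_orthogonal_apply, Submodule.reflection_singleton_apply]
  simp only [RCLike.ofReal_real_eq_id, id]
  module

lemma isometry_mirror (b : Euc N) : Isometry (mirror b) := by
  have : mirror b = fun y => Submodule.reflection (ℝ ∙ b)ᗮ y + (2 : ℝ) • b :=
    funext (mirror_eq_reflection b)
  rw [this]
  exact (isometry_add_right _).comp (LinearIsometryEquiv.isometry _)

lemma measurePreserving_mirror (b : Euc N) : MeasurePreserving (mirror b) := by
  have : mirror b = (fun y => y + (2 : ℝ) • b) ∘ Submodule.reflection (ℝ ∙ b)ᗮ :=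
    funext (mirror_eq_reflection b)
  rw [this]
  exact (measurePreserving_add_right _ _).comp (LinearIsometryEquiv.measurePreserving _)

lemma measurable_mirror : Measurable fun z : Euc N × Euc N => mirror z.1 z.2 := by
  unfold mirror
  fun_prop

lemma measurable_side (b : Euc N) : Measurable (side b) := by
  unfold side
  fun_prop

lemma mirror_eq_add {b : Euc N} (hb : b ≠ 0) (y : Euc N) :
    mirror b y = y + (2 * side b y / ‖b‖ ^ 2) • b := by
  have : ‖b‖ ≠ 0 := norm_ne_zero_iff.2 hb
  rw [mirror, side]
  congr 2
  field_simp

lemma side_mirror {b : Euc N} (hb : b ≠ 0) (y : Euc N) : side b (mirror b y) = -side b y := by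
  have : ‖b‖ ≠ 0 := norm_ne_zero_iff.2 hb
  rw [mirror_eq_add hb, side, inner_add_right, inner_smul_right, real_inner_self_eq_norm_sq]
  field_simp
  rw [side]
  ring

lemma mirror_mirror {b : Euc N} (hb : b ≠ 0) (y : Euc N) : mirror b (mirror b y) = y := by
  rw [mirror_eq_add hb (mirror b y), side_mirror hb, mirror_eq_add hb y]
  module

lemma mirror_of_side_eq_zero {b : Euc N} (hb : b ≠ 0) {y : Euc N} (h : side b y = 0) :
    mirror b y = y := by
  simp [mirror_eq_add hb, h]

lemma norm_mirror_sub_sq {b : Euc N} (hb : b ≠ 0) (x y : Euc N) :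
    ‖mirror b y - x‖ ^ 2 = ‖y - x‖ ^ 2 + 4 * side b x * side b y / ‖b‖ ^ 2 := by
  have : ‖b‖ ≠ 0 := norm_ne_zero_iff.2 hb
  have h1 : mirror b y - x = (y - x) + (2 * side b y / ‖b‖ ^ 2) • b := by
    rw [mirror_eq_add hb]; abel
  have h2 : inner ℝ (y - x) b = side b x - side b y := by
    rw [real_inner_comm, inner_sub_right, side, side]; ring
  rw [h1, norm_add_sq_real, inner_smul_right, norm_smul, mul_pow, h2, Real.norm_eq_abs, sq_abs]
  field_simp
  ring

lemma enorm_rpow_neg_anti (hp : 0 ≤ p) {x y : Euc N} (h : ‖x‖ ≤ ‖y‖) :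
    ‖y‖ₑ ^ (-p) ≤ ‖x‖ₑ ^ (-p) := by
  rw [ENNReal.rpow_neg, ENNReal.rpow_neg, ENNReal.inv_le_inv]
  exact ENNReal.rpow_le_rpow (enorm_le_iff_norm_le.2 h) hp

lemma enorm_rpow_neg_strictAnti (hp : 0 < p) {x y : Euc N} (h : ‖x‖ < ‖y‖) :
    ‖y‖ₑ ^ (-p) < ‖x‖ₑ ^ (-p) := by
  rw [ENNReal.rpow_neg, ENNReal.rpow_neg, ENNReal.inv_lt_inv]
  refine ENNReal.rpow_lt_rpow ?_ hp
  rwa [← ofReal_norm, ← ofReal_norm, ENNReal.ofReal_lt_ofReal_iff_of_nonneg (norm_nonneg x)]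

/-- The two-point symmetrization of `A` with respect to the mirror through `b`. -/
def polarization (b : Euc N) (A : Set (Euc N)) : Set (Euc N) :=
  {x | (0 ≤ side b x ∧ (x ∈ A ∨ mirror b x ∈ A)) ∨ (side b x < 0 ∧ x ∈ A ∧ mirror b x ∈ A)}

lemma measurableSet_polarization (b : Euc N) {A : Set (Euc N)} (hA : MeasurableSet A) :
    MeasurableSet (polarization b A) := by
  have h1 := measurable_side b
  have h2 : MeasurableSet {x | mirror b x ∈ A} := (measurePreserving_mirror b).measurable hA
  have h3 : MeasurableSet {x | 0 ≤ side b x} := measurableSet_le measurable_const h1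
  have h4 : MeasurableSet {x | side b x < 0} := measurableSet_lt h1 measurable_const
  exact (h3.inter (hA.union h2)).union (h4.inter (hA.inter h2))

lemma mem_polarization {b : Euc N} {A : Set (Euc N)} {x : Euc N} (hx : 0 ≤ side b x) :
    x ∈ polarization b A ↔ x ∈ A ∨ mirror b x ∈ A := by
  simp [polarization, hx, not_lt.2 hx]

lemma mirror_mem_polarization {b : Euc N} (hb : b ≠ 0) {A : Set (Euc N)} {x : Euc N}
    (hx : 0 ≤ side b x) : mirror b x ∈ polarization b A ↔ x ∈ A ∧ mirror b x ∈ A := by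
  rcases hx.eq_or_lt with h | h
  · simp [mirror_of_side_eq_zero hb h.symm, mem_polarization hx]
  · simp [polarization, side_mirror hb, mirror_mirror hb, not_le.2 h, h, and_comm]

lemma two_mul_lintegral_eq (b : Euc N) {f : Euc N → ℝ≥0∞} (hf : Measurable f) :
    2 * ∫⁻ x, f x = ∫⁻ x, (f x + f (mirror b x)) := by
  rw [lintegral_add_left hf, (measurePreserving_mirror b).lintegral_comp hf, two_mul]

/-- A pointwise inequality between mirror-symmetrized functions needs to be checked
only on one side of the mirror. -/
lemma forall_symmetrized_le {b : Euc N} (hb : b ≠ 0) {f g : Euc N → ℝ≥0∞}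
    (h : ∀ x, 0 ≤ side b x → f x + f (mirror b x) ≤ g x + g (mirror b x)) (x : Euc N) :
    f x + f (mirror b x) ≤ g x + g (mirror b x) := by
  rcases le_total 0 (side b x) with hx | hx
  · exact h x hx
  · have := h (mirror b x) (by rw [side_mirror hb]; linarith)
    rwa [mirror_mirror hb, add_comm, add_comm (g _)] at this

lemma lintegral_le_of_symmetrized_le {b : Euc N} (hb : b ≠ 0) {f g : Euc N → ℝ≥0∞}
    (hf : Measurable f) (hg : Measurable g)
    (h : ∀ x, 0 ≤ side b x → f x + f (mirror b x) ≤ g x + g (mirror b x)) :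
    ∫⁻ x, f x ≤ ∫⁻ x, g x := by
  have h2 : 2 * ∫⁻ x, f x ≤ 2 * ∫⁻ x, g x := by
    rw [two_mul_lintegral_eq b hf, two_mul_lintegral_eq b hg]
    exact lintegral_mono (forall_symmetrized_le hb h)
  rwa [ENNReal.mul_le_mul_iff_right (by simp) (by simp)] at h2

lemma volume_polarization {b : Euc N} (hb : b ≠ 0) {A : Set (Euc N)} (hA : MeasurableSet A) :
    volume (polarization b A) = volume A := by
  have hP := measurableSet_polarization b hA
  rw [← lintegral_indicator_one hA, ← lintegral_indicator_one hP]
  classical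
  apply le_antisymm <;>
  · refine lintegral_le_of_symmetrized_le hb (by fun_prop (disch := assumption))
      (by fun_prop (disch := assumption)) fun x hx => ?_
    simp only [Set.indicator_apply, mem_polarization hx, mirror_mem_polarization hb hx]
    by_cases h1 : x ∈ A <;> by_cases h2 : mirror b x ∈ A <;> simp [h1, h2]

lemma norm_le_norm_mirror {b : Euc N} {x : Euc N} (hx : 0 ≤ side b x) :
    ‖x‖ ≤ ‖mirror b x‖ := by
  rcases eq_or_ne b 0 with rfl | hb
  · simp [mirror]
  · have h := norm_mirror_sub_sq hb 0 x
    have h0 : side b 0 = ‖b‖ ^ 2 := by simp [side]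
    rw [h0] at h
    simp only [sub_zero] at h
    have : 0 ≤ 4 * ‖b‖ ^ 2 * side b x / ‖b‖ ^ 2 := by positivity
    exact le_of_sq_le_sq (by linarith) (norm_nonneg _)

lemma polarization_subset_ball (b : Euc N) {A : Set (Euc N)} {R : ℝ} (hA : A ⊆ ball 0 R) :
    polarization b A ⊆ ball 0 R := by
  rintro x (⟨hx, h | h⟩ | ⟨-, h, -⟩)
  · exact hA h
  · have := hA h
    rw [mem_ball_zero_iff] at this ⊢
    exact (norm_le_norm_mirror hx).trans_lt this
  · exact hA h

/-- Polarization increases the overlap with a centered ball. -/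
lemma volume_inter_ball_add_le {b : Euc N} (hb : b ≠ 0) {A : Set (Euc N)} (hA : MeasurableSet A)
    (r : ℝ) :
    volume (A ∩ ball 0 r) + volume {y | y ∈ ball 0 r \ A ∧ mirror b y ∈ A \ ball 0 r} ≤
      volume (polarization b A ∩ ball 0 r) := by
  have hP := measurableSet_polarization b hA
  have hB : MeasurableSet (ball (0 : Euc N) r) := measurableSet_ball
  have hG : MeasurableSet {y | y ∈ ball 0 r \ A ∧ mirror b y ∈ A \ ball 0 r} :=
    (hB.diff hA).inter ((measurePreserving_mirror b).measurable (hA.diff hB))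
  have hAB := hA.inter hB
  have hPB := hP.inter hB
  rw [← lintegral_indicator_one hAB, ← lintegral_indicator_one hG, ← lintegral_indicator_one hPB,
    ← lintegral_add_left (by fun_prop (disch := assumption))]
  classical
  refine lintegral_le_of_symmetrized_le hb (by fun_prop (disch := assumption))
      (by fun_prop (disch := assumption)) fun x hx => ?_
  have h3 : mirror b x ∈ ball (0 : Euc N) r → x ∈ ball (0 : Euc N) r := by
    simp only [mem_ball_zero_iff]
    exact (norm_le_norm_mirror hx).trans_lt
  simp only [Set.indicator_apply, mem_polarization hx, mirror_mem_polarization hb hx,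
    Set.mem_inter_iff, Set.mem_ofPred_eq, Set.mem_sdiff, mirror_mirror hb]
  clear hG hB hAB hPB hP
  generalize ball (0 : Euc N) r = B at *
  by_cases h1 : x ∈ A <;> by_cases h2 : mirror b x ∈ A <;>
    by_cases h4 : mirror b x ∈ B <;> by_cases h5 : x ∈ B <;> simp_all

/-- The kernel restricted to `A × A`. -/
noncomputable def energyDensity (p : ℝ) (A : Set (Euc N)) (z : Euc N × Euc N) : ℝ≥0∞ :=
  (A ×ˢ A).indicator (fun z => ‖z.2 - z.1‖ₑ ^ (-p)) z

lemma measurable_energyDensity (p : ℝ) {A : Set (Euc N)} (hA : MeasurableSet A) :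
    Measurable (energyDensity p A) :=
  (measurable_kernel p).indicator (hA.prod hA)

lemma energy_eq_lintegral_prod (p : ℝ) {A : Set (Euc N)} (hA : MeasurableSet A) :
    energy p A = ∫⁻ z, energyDensity p A z := by
  unfold energyDensity
  rw [lintegral_indicator (hA.prod hA), Measure.volume_eq_prod, ← Measure.prod_restrict,
    lintegral_prod _ (measurable_kernel p).aemeasurable]
  rfl

/-- The energy density summed over the four images of a pair of points under a mirror. -/
noncomputable def mirrorDensity (p : ℝ) (b : Euc N) (A : Set (Euc N)) (z : Euc N × Euc N) : ℝ≥0∞ :=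
  (energyDensity p A z + energyDensity p A (mirror b z.1, mirror b z.2)) +
    (energyDensity p A (mirror b z.1, z.2) + energyDensity p A (z.1, mirror b z.2))

lemma measurable_mirrorDensity (p : ℝ) (b : Euc N) {A : Set (Euc N)} (hA : MeasurableSet A) :
    Measurable (mirrorDensity p b A) := by
  have h := measurable_energyDensity p hA
  have hm := (measurePreserving_mirror b).measurable
  unfold mirrorDensity
  fun_prop

lemma four_mul_energy (p : ℝ) (b : Euc N) {A : Set (Euc N)} (hA : MeasurableSet A) :
    4 * energy p A = ∫⁻ z, mirrorDensity p b A z := by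
  have h := measurable_energyDensity p hA
  have hm := measurePreserving_mirror b
  have hmm := hm.measurable
  have hid := MeasurePreserving.id (volume : Measure (Euc N))
  have e1 := (hm.prod hm).lintegral_comp h
  have e2 := (hm.prod hid).lintegral_comp h
  have e3 := (hid.prod hm).lintegral_comp h
  simp only [Prod.map, id, ← Measure.volume_eq_prod] at e1 e2 e3
  unfold mirrorDensity
  rw [lintegral_add_left (by fun_prop), lintegral_add_left h, lintegral_add_left (by fun_prop),
    e1, e2, e3, energy_eq_lintegral_prod p hA]
  ring

lemma mirrorDensity_mirror_left {b : Euc N} (hb : b ≠ 0) (A : Set (Euc N)) (x y : Euc N) :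
    mirrorDensity p b A (mirror b x, y) = mirrorDensity p b A (x, y) := by
  simp only [mirrorDensity, mirror_mirror hb]
  ring

lemma mirrorDensity_mirror_right {b : Euc N} (hb : b ≠ 0) (A : Set (Euc N)) (x y : Euc N) :
    mirrorDensity p b A (x, mirror b y) = mirrorDensity p b A (x, y) := by
  simp only [mirrorDensity, mirror_mirror hb]
  ring

lemma norm_mirror_sub_mirror (b x y : Euc N) : ‖mirror b y - mirror b x‖ = ‖y - x‖ := by
  rw [← dist_eq_norm, ← dist_eq_norm, (isometry_mirror b).dist_eq]

open Classical in
lemma mirrorDensity_eq {b : Euc N} (hb : b ≠ 0) (A : Set (Euc N)) (x y : Euc N) :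
    mirrorDensity p b A (x, y) =
      ((if x ∈ A ∧ y ∈ A then ‖y - x‖ₑ ^ (-p) else 0) +
        (if mirror b x ∈ A ∧ mirror b y ∈ A then ‖y - x‖ₑ ^ (-p) else 0)) +
      ((if mirror b x ∈ A ∧ y ∈ A then ‖mirror b y - x‖ₑ ^ (-p) else 0) +
        (if x ∈ A ∧ mirror b y ∈ A then ‖mirror b y - x‖ₑ ^ (-p) else 0)) := by
  have e1 : ‖mirror b y - mirror b x‖ₑ = ‖y - x‖ₑ := by
    rw [← ofReal_norm, norm_mirror_sub_mirror, ofReal_norm]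
  have e2 : ‖y - mirror b x‖ₑ = ‖mirror b y - x‖ₑ := by
    rw [← ofReal_norm, ← norm_mirror_sub_mirror b, mirror_mirror hb, ofReal_norm]
  simp only [mirrorDensity, energyDensity, Set.indicator_apply, Set.mem_prod, e1, e2]

lemma norm_sub_le_norm_mirror_sub {b x y : Euc N} (hb : b ≠ 0) (hx : 0 ≤ side b x)
    (hy : 0 ≤ side b y) : ‖y - x‖ ≤ ‖mirror b y - x‖ := by
  refine le_of_sq_le_sq ?_ (norm_nonneg _)
  rw [norm_mirror_sub_sq hb]
  have : 0 ≤ 4 * side b x * side b y / ‖b‖ ^ 2 := by positivity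
  linarith

lemma norm_sub_lt_norm_mirror_sub {b x y : Euc N} (hb : b ≠ 0) (hx : 0 < side b x)
    (hy : 0 < side b y) : ‖y - x‖ < ‖mirror b y - x‖ := by
  refine lt_of_pow_lt_pow_left₀ 2 (norm_nonneg _) ?_
  rw [norm_mirror_sub_sq hb]
  have : 0 < ‖b‖ := norm_pos_iff.2 hb
  have : 0 < 4 * side b x * side b y / ‖b‖ ^ 2 := by positivity
  linarith

lemma mirrorDensity_le_polarization (hp : 0 ≤ p) {b : Euc N} (hb : b ≠ 0) (A : Set (Euc N))
    (z : Euc N × Euc N) : mirrorDensity p b A z ≤ mirrorDensity p b (polarization b A) z := by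
  obtain ⟨x, y⟩ := z
  wlog hx : 0 ≤ side b x generalizing x
  · have := this (mirror b x) (by rw [side_mirror hb]; linarith)
    rwa [mirrorDensity_mirror_left hb, mirrorDensity_mirror_left hb] at this
  wlog hy : 0 ≤ side b y generalizing y
  · have := this (mirror b y) (by rw [side_mirror hb]; linarith)
    rwa [mirrorDensity_mirror_right hb, mirrorDensity_mirror_right hb] at this
  have hk := enorm_rpow_neg_anti hp (norm_sub_le_norm_mirror_sub hb hx hy)
  have e1 := mem_polarization (A := A) hx
  have e2 := mem_polarization (A := A) hy
  have e3 := mirror_mem_polarization hb (A := A) hx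
  have e4 := mirror_mem_polarization hb (A := A) hy
  rw [mirrorDensity_eq hb, mirrorDensity_eq hb]
  by_cases h1 : x ∈ A <;> by_cases h2 : mirror b x ∈ A <;> by_cases h3 : y ∈ A <;>
    by_cases h4 : mirror b y ∈ A <;> simp [e1, e2, e3, e4, h1, h2, h3, h4, hk]

lemma energy_le_energy_polarization (hp : 0 ≤ p) {b : Euc N} (hb : b ≠ 0) {A : Set (Euc N)}
    (hA : MeasurableSet A) : energy p A ≤ energy p (polarization b A) := by
  have h : 4 * energy p A ≤ 4 * energy p (polarization b A) := by
    rw [four_mul_energy p b hA, four_mul_energy p b (measurableSet_polarization b hA)]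
    exact lintegral_mono (mirrorDensity_le_polarization hp hb A)
  rwa [ENNReal.mul_le_mul_iff_right (by simp) (by simp)] at h

/-- If polarization does not increase the energy, then `A` or its mirror image is polarized. -/
lemma volume_eq_zero_or_of_energy_polarization_le (hp : 0 < p) {b : Euc N} (hb : b ≠ 0)
    {A : Set (Euc N)} (hA : MeasurableSet A) (hfin : energy p A ≠ ∞)
    (h : energy p (polarization b A) ≤ energy p A) :
    volume {x | 0 < side b x ∧ x ∈ A ∧ mirror b x ∉ A} = 0 ∨
      volume {x | 0 < side b x ∧ x ∉ A ∧ mirror b x ∈ A} = 0 := by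
  have hP := measurableSet_polarization b hA
  have hae : mirrorDensity p b A =ᵐ[volume] mirrorDensity p b (polarization b A) := by
    refine ae_eq_of_ae_le_of_lintegral_le
      (.of_forall (mirrorDensity_le_polarization hp.le hb A)) ?_
      (measurable_mirrorDensity p b hP).aemeasurable ?_
    · rw [← four_mul_energy p b hA]
      exact ENNReal.mul_ne_top (by simp) hfin
    · rw [← four_mul_energy p b hA, ← four_mul_energy p b hP]
      gcongr
  rw [← mul_eq_zero, ← Measure.prod_prod, ← Measure.volume_eq_prod]
  refine measure_mono_null ?_ (ae_iff.1 hae)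
  rintro ⟨x, y⟩ ⟨⟨hx, hxA, hxA'⟩, hy, hyA, hyA'⟩
  have hk := enorm_rpow_neg_strictAnti hp (norm_sub_lt_norm_mirror_sub hb hx hy)
  have e1 := mem_polarization (A := A) hx.le
  have e2 := mem_polarization (A := A) hy.le
  have e3 := mirror_mem_polarization hb (A := A) hx.le
  have e4 := mirror_mem_polarization hb (A := A) hy.le
  rw [Set.mem_ofPred_eq, mirrorDensity_eq hb, mirrorDensity_eq hb]
  simpa [e1, e2, e3, e4, hxA, hxA', hyA, hyA'] using hk.ne

lemma norm_inv_smul_sub_le {b c : Euc N} {η : ℝ} (hη : 0 < η) (hb : η ≤ ‖b‖) (hc : c ≠ 0) :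
    ‖‖b‖⁻¹ • b - ‖c‖⁻¹ • c‖ ≤ 2 / η * ‖b - c‖ := by
  have hb0 : 0 < ‖b‖ := hη.trans_le hb
  have hc0 : 0 < ‖c‖ := norm_pos_iff.2 hc
  have h : ‖b‖⁻¹ • b - ‖c‖⁻¹ • c = ‖b‖⁻¹ • (b - c) + (‖b‖⁻¹ * (‖c‖ - ‖b‖) * ‖c‖⁻¹) • c := by
    have : ‖b‖⁻¹ * (‖c‖ - ‖b‖) * ‖c‖⁻¹ = ‖b‖⁻¹ - ‖c‖⁻¹ := by field_simp
    rw [this]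
    module
  have h3 : ‖b‖⁻¹ ≤ η⁻¹ := inv_anti₀ hη hb
  have h4 : |‖c‖ - ‖b‖| ≤ ‖b - c‖ := by rw [norm_sub_rev]; exact abs_norm_sub_norm_le c b
  calc ‖‖b‖⁻¹ • b - ‖c‖⁻¹ • c‖ ≤ ‖b‖⁻¹ * ‖b - c‖ + ‖b‖⁻¹ * |‖c‖ - ‖b‖| := by
        rw [h]
        refine (norm_add_le _ _).trans_eq ?_
        rw [norm_smul, norm_smul, norm_mul, norm_mul, norm_inv, norm_inv, norm_norm, norm_norm,
          Real.norm_eq_abs]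
        field_simp
    _ ≤ η⁻¹ * ‖b - c‖ + η⁻¹ * ‖b - c‖ := by gcongr
    _ = 2 / η * ‖b - c‖ := by ring

lemma mirror_eq_normalized (b y : Euc N) :
    mirror b y = y + (2 : ℝ) • b - (2 * inner ℝ (‖b‖⁻¹ • b) y) • (‖b‖⁻¹ • b) := by
  rw [mirror, inner_smul_left, smul_smul]
  simp only [RCLike.conj_to_real]
  match_scalars
  · ring
  · ring

/-- Away from zero, the image of a fixed point is Lipschitz in the mirror. -/
lemma lipschitzOnWith_mirror {y : Euc N} (hy : ‖y‖ ≤ 1) {η : ℝ} (hη : 0 < η) :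
    LipschitzOnWith (Real.toNNReal (2 + 8 / η)) (fun b => mirror b y) {b | η ≤ ‖b‖} := by
  refine LipschitzOnWith.of_dist_le_mul fun b hb c hc => ?_
  simp only [Set.mem_ofPred_eq] at hb hc
  have hb0 : b ≠ 0 := norm_pos_iff.1 (hη.trans_le hb)
  have hc0 : c ≠ 0 := norm_pos_iff.1 (hη.trans_le hc)
  rw [Real.coe_toNNReal _ (by positivity), dist_eq_norm, dist_eq_norm, mirror_eq_normalized,
    mirror_eq_normalized]
  have hn := norm_inv_smul_sub_le hη hb hc0
  set n := ‖b‖⁻¹ • b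
  set k := ‖c‖⁻¹ • c
  have hn1 : ‖n‖ = 1 := norm_smul_inv_norm (𝕜 := ℝ) hb0
  have hk1 : ‖k‖ = 1 := norm_smul_inv_norm (𝕜 := ℝ) hc0
  have e : y + (2 : ℝ) • b - (2 * inner ℝ n y) • n - (y + (2 : ℝ) • c - (2 * inner ℝ k y) • k)
      = (2 : ℝ) • (b - c) - ((2 * inner ℝ (n - k) y) • n + (2 * inner ℝ k y) • (n - k)) := by
    rw [inner_sub_left]; module
  have i1 : |inner ℝ (n - k) y| ≤ ‖n - k‖ * 1 :=
    (abs_real_inner_le_norm _ _).trans (by gcongr)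
  have i2 : |inner ℝ k y| ≤ 1 :=
    (abs_real_inner_le_norm _ _).trans (by rw [hk1, one_mul]; exact hy)
  rw [e]
  calc _ ≤ ‖(2 : ℝ) • (b - c)‖ + (‖(2 * inner ℝ (n - k) y) • n‖ + ‖(2 * inner ℝ k y) • (n - k)‖) :=
        (norm_sub_le _ _).trans (by gcongr; exact norm_add_le _ _)
    _ = 2 * ‖b - c‖ + (2 * |inner ℝ (n - k) y| + 2 * |inner ℝ k y| * ‖n - k‖) := by
        simp [norm_smul, hn1]
    _ ≤ 2 * ‖b - c‖ + (2 * (‖n - k‖ * 1) + 2 * 1 * ‖n - k‖) := by gcongr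
    _ ≤ (2 + 8 / η) * ‖b - c‖ := by
        have : 8 / η * ‖b - c‖ = 4 * (2 / η * ‖b - c‖) := by ring
        linarith

lemma volume_image_le_of_lipschitzOnWith {K : ℝ≥0} {f : Euc N → Euc N} {s : Set (Euc N)}
    (h : LipschitzOnWith K f s) : volume (f '' s) ≤ (K : ℝ≥0∞) ^ N * volume s := by
  have hv : (volume : Measure (Euc N)) =
      Measure.addHaarScalarFactor volume (Measure.hausdorffMeasure (Module.finrank ℝ (Euc N))) •
        (Measure.hausdorffMeasure (Module.finrank ℝ (Euc N)) : Measure (Euc N)) :=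
    Measure.isAddLeftInvariant_eq_smul _ _
  have hH := h.hausdorffMeasure_image_le (d := Module.finrank ℝ (Euc N)) (by positivity)
  rw [hv, Measure.smul_apply, Measure.smul_apply, mul_smul_comm]
  gcongr
  simpa using hH

/-- The mirror exchanging two points of different norms. -/
lemma exists_mirror_eq {x y : Euc N} (hxy : ‖y‖ < ‖x‖) :
    ∃ b : Euc N, (‖x‖ - ‖y‖) / 2 ≤ ‖b‖ ∧ ‖b‖ ≤ ‖x‖ ∧ mirror b y = x := by
  have hne : x - y ≠ 0 := sub_ne_zero.2 (by rintro rfl; exact lt_irrefl _ hxy)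
  have hpos : 0 < ‖x - y‖ := norm_pos_iff.2 hne
  set d := (‖x‖ ^ 2 - ‖y‖ ^ 2) / 2 with hd
  have hd0 : 0 < d := by have := norm_nonneg y; rw [hd]; nlinarith
  have hnb : ‖(d / ‖x - y‖ ^ 2) • (x - y)‖ = d / ‖x - y‖ := by
    rw [norm_smul, Real.norm_of_nonneg (by positivity)]
    field_simp
  have hsq : ‖x - y‖ ^ 2 = ‖x‖ ^ 2 - 2 * inner ℝ x y + ‖y‖ ^ 2 := norm_sub_sq_real x y
  have hin : inner ℝ (x - y) y = d - ‖x - y‖ ^ 2 / 2 := by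
    rw [inner_sub_left, real_inner_self_eq_norm_sq, hsq, hd]; ring
  refine ⟨(d / ‖x - y‖ ^ 2) • (x - y), ?_, ?_, ?_⟩
  · rw [hnb, le_div_iff₀ hpos, hd]
    have h1 : ‖x - y‖ ≤ ‖x‖ + ‖y‖ := norm_sub_le x y
    nlinarith
  · rw [hnb, div_le_iff₀ hpos, hd]
    have h1 : ‖x‖ - ‖y‖ ≤ ‖x - y‖ := norm_sub_norm_le x y
    nlinarith [norm_nonneg y, norm_nonneg x]
  · rw [mirror, hnb, inner_smul_left, hin]
    simp only [RCLike.conj_to_real]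
    have : 2 * (1 - d / ‖x - y‖ ^ 2 * (d - ‖x - y‖ ^ 2 / 2) / (d / ‖x - y‖) ^ 2) *
        (d / ‖x - y‖ ^ 2) = 1 := by
      field_simp
      ring
    rw [smul_smul, this, one_smul, add_sub_cancel]

lemma exists_volume_shell_le {m : ℝ≥0∞} (hm : m ≠ 0) :
    ∃ η : ℝ, 0 < η ∧ volume (ball (0 : Euc N) (1 + 2 * η)) ≤ volume (ball (0 : Euc N) 1) + m := by
  have hc : Filter.Tendsto (fun η : ℝ => volume (ball (0 : Euc N) (1 + 2 * η)))
      (nhdsWithin 0 (Set.Ioi 0)) (nhds (volume (ball (0 : Euc N) 1))) := by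
    have e : ∀ η ∈ Set.Ioi (0 : ℝ), ENNReal.ofReal ((1 + 2 * η) ^ N) * volume (ball (0 : Euc N) 1)
        = volume (ball (0 : Euc N) (1 + 2 * η)) := fun η hη => by
      have : (0 : ℝ) < 1 + 2 * η := by have := Set.mem_Ioi.1 hη; positivity
      rw [Measure.addHaar_ball_of_pos _ _ this]
      simp
    refine Filter.Tendsto.congr' (eventually_nhdsWithin_of_forall e) ?_
    have h1 : Filter.Tendsto (fun η : ℝ => ENNReal.ofReal ((1 + 2 * η) ^ N))
        (nhdsWithin 0 (Set.Ioi 0)) (nhds 1) := by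
      have : Continuous fun η : ℝ => ENNReal.ofReal ((1 + 2 * η) ^ N) :=
        ENNReal.continuous_ofReal.comp (by fun_prop)
      simpa using (this.tendsto 0).mono_left nhdsWithin_le_nhds
    simpa using ENNReal.Tendsto.mul_const h1 (Or.inr measure_ball_lt_top.ne)
  have hlt : volume (ball (0 : Euc N) 1) < volume (ball (0 : Euc N) 1) + m :=
    ENNReal.lt_add_right measure_ball_lt_top.ne hm
  obtain ⟨η, h1, h2⟩ := ((hc.eventually_lt_const hlt).and self_mem_nhdsWithin).exists
  exact ⟨η, h2, h1.le⟩

/-- Some mirror exchanges a definite part of a set in the unit ball with a set outside of it. -/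
lemma exists_mirror_overlap (R : ℝ) {m : ℝ≥0∞} (hm : m ≠ 0) :
    ∃ φ : ℝ≥0∞, φ ≠ 0 ∧ ∀ A C : Set (Euc N), MeasurableSet A → MeasurableSet C →
      A ⊆ ball 0 R → Disjoint A (ball 0 1) → C ⊆ ball 0 1 → m ≤ volume A → m ≤ volume C →
      ∃ b ≠ 0, φ ≤ volume {y | y ∈ C ∧ mirror b y ∈ A} := by
  have hlt : ∀ C : Set (Euc N), C ⊆ ball 0 1 → volume C < ∞ := fun C hC =>
    (measure_mono hC).trans_lt measure_ball_lt_top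
  rcases eq_or_ne m ∞ with rfl | hmt
  · exact ⟨1, one_ne_zero, fun A C _ _ _ _ hC _ h => absurd (hlt C hC) (by simpa using h)⟩
  have hm2 : m / 2 ≠ 0 := (ENNReal.half_pos hm).ne'
  obtain ⟨η, hη, hshell⟩ := exists_volume_shell_le (N := N) hm2
  set S : Set (Euc N) := {b | η ≤ ‖b‖ ∧ ‖b‖ ≤ R} with hS
  set K : ℝ≥0 := Real.toNNReal (2 + 8 / η) with hK
  have hKpos : 0 < K := Real.toNNReal_pos.2 (by positivity)
  have hSsub : S ⊆ closedBall 0 R := fun b hb => by simpa using hb.2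
  have hSfin : volume S < ∞ := (measure_mono hSsub).trans_lt measure_closedBall_lt_top
  set X := m * (m / 2) with hX
  have hX0 : X ≠ 0 := mul_ne_zero hm hm2
  have hXt : X ≠ ∞ := ENNReal.mul_ne_top hmt (ENNReal.div_ne_top hmt two_ne_zero)
  set L := 2 * ((K : ℝ≥0∞) ^ N * (volume S + 1)) with hL
  have hL0 : L ≠ 0 := by
    have : (K : ℝ≥0∞) ≠ 0 := by simpa using hKpos.ne'
    exact mul_ne_zero two_ne_zero (mul_ne_zero (pow_ne_zero _ this) (by simp))
  have hLt : L ≠ ∞ := ENNReal.mul_ne_top (by simp)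
    (ENNReal.mul_ne_top (by simp) (ENNReal.add_ne_top.2 ⟨hSfin.ne, by simp⟩))
  refine ⟨X / L, (ENNReal.div_pos hX0 hLt).ne', fun A C hA hC hAR hA1 hC1 hmA hmC => ?_⟩
  by_contra! hcon
  set A' := A \ ball 0 (1 + 2 * η) with hA'
  have hA'm : MeasurableSet A' := hA.diff measurableSet_ball
  have hvA' : m / 2 ≤ volume A' := by
    have hsub : A ⊆ A' ∪ (ball 0 (1 + 2 * η) \ ball 0 1) := fun x hx => by
      by_cases h : x ∈ ball (0 : Euc N) (1 + 2 * η)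
      · exact Or.inr ⟨h, fun h' => Set.disjoint_left.1 hA1 hx h'⟩
      · exact Or.inl ⟨hx, h⟩
    have h1 : volume (ball (0 : Euc N) (1 + 2 * η) \ ball 0 1) ≤ m / 2 := by
      rw [measure_sdiff (ball_subset_ball (by linarith)) measurableSet_ball.nullMeasurableSet
        measure_ball_lt_top.ne]
      exact tsub_le_iff_left.2 hshell
    have h2 : m / 2 + m / 2 ≤ volume A' + m / 2 := by
      rw [ENNReal.add_halves]
      exact hmA.trans ((measure_mono hsub).trans ((measure_union_le _ _).trans (by gcongr)))
    exact (ENNReal.add_le_add_iff_right (ENNReal.div_ne_top hmt two_ne_zero)).1 h2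
  have hfib : ∀ y ∈ C, m / 2 ≤ (K : ℝ≥0∞) ^ N * volume {b | b ∈ S ∧ mirror b y ∈ A} :=
      fun y hy => by
    have hy1 : ‖y‖ < 1 := by simpa using hC1 hy
    have hlip := (lipschitzOnWith_mirror hy1.le hη).mono
      (fun b hb => hb.1.1 : {b | b ∈ S ∧ mirror b y ∈ A} ⊆ {b | η ≤ ‖b‖})
    refine hvA'.trans ((measure_mono fun x hx => ?_).trans
      (volume_image_le_of_lipschitzOnWith hlip))
    have hx1 : 1 + 2 * η ≤ ‖x‖ := by simpa using hx.2
    have hxR : ‖x‖ < R := by simpa using hAR hx.1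
    obtain ⟨b, hb1, hb2, hb3⟩ := exists_mirror_eq (x := x) (y := y) (by linarith)
    exact ⟨b, ⟨⟨by linarith, by linarith⟩, by rw [hb3]; exact hx.1⟩, hb3⟩
  have hSm : MeasurableSet S :=
    (measurableSet_le measurable_const measurable_norm).inter
      (measurableSet_le measurable_norm measurable_const)
  set T : Set (Euc N × Euc N) := {z | z.1 ∈ S ∧ z.2 ∈ C ∧ mirror z.1 z.2 ∈ A} with hT
  have hTm : MeasurableSet T :=
    (measurable_fst hSm).inter ((measurable_snd hC).inter (measurable_mirror hA))
  have hb0 : ∀ b ∈ S, b ≠ 0 := fun b hb => norm_pos_iff.1 (hη.trans_le hb.1)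
  have e1 : (volume.prod volume) T ≤ X / L * volume S := by
    rw [Measure.prod_apply hTm, ← setLIntegral_const, ← lintegral_indicator hSm]
    refine lintegral_mono fun b => ?_
    by_cases hb : b ∈ S
    · rw [Set.indicator_of_mem hb]
      refine le_trans (measure_mono fun y hy => ?_) (hcon b (hb0 b hb)).le
      exact hy.2
    · rw [Set.indicator_of_notMem hb]
      have : Prod.mk b ⁻¹' T = ∅ := Set.eq_empty_of_forall_notMem fun y hy => hb hy.1
      simp [this]
  have e2 : X ≤ (K : ℝ≥0∞) ^ N * (volume.prod volume) T := by
    rw [Measure.prod_apply_symm hTm, ← lintegral_const_mul _ (measurable_measure_prodMk_right hTm)]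
    calc X ≤ ∫⁻ _ in C, m / 2 := by
          rw [setLIntegral_const, hX, mul_comm]; gcongr
      _ ≤ _ := by
          rw [← lintegral_indicator hC]
          refine lintegral_mono fun y => ?_
          by_cases hy : y ∈ C
          · rw [Set.indicator_of_mem hy]
            refine (hfib y hy).trans ?_
            gcongr
            exact fun b hb => ⟨hb.1, hy, hb.2⟩
          · simp [Set.indicator_of_notMem hy]
  have e3 : 2 * X ≤ X := by
    calc 2 * X ≤ 2 * ((K : ℝ≥0∞) ^ N * (X / L * (volume S + 1))) := by
          gcongr
          refine e2.trans ?_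
          gcongr
          refine e1.trans ?_
          gcongr
          exact le_self_add
      _ = X / L * L := by rw [hL]; ring
      _ = X := ENNReal.div_mul_cancel hL0 hLt
  rw [two_mul] at e3
  exact hX0 (by
    have := (ENNReal.add_le_add_iff_left hXt (b := X) (c := 0)).1 (by simpa using e3)
    simpa using this)

/-- The Riesz rearrangement inequality for bounded sets with the volume of the unit ball. -/
theorem energy_le_energy_ball (hN : 1 ≤ N) (hp : 0 ≤ p) (hpN : p < N) {A : Set (Euc N)}
    (hA : MeasurableSet A) (hvol : volume A = volume (ball (0 : Euc N) 1)) {R : ℝ}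
    (hAR : A ⊆ ball 0 R) : energy p A ≤ energy p (ball (0 : Euc N) 1) := by
  set ω := volume (ball (0 : Euc N) 1) with hω
  have hωt : ω ≠ ∞ := measure_ball_lt_top.ne
  let G := {F : Set (Euc N) // MeasurableSet F ∧ volume F = ω ∧ F ⊆ ball 0 R ∧
    energy p A ≤ energy p F}
  have : Nonempty G := ⟨⟨A, hA, hvol, hAR, le_rfl⟩⟩
  have hin : ∀ F : G, volume (F.1 ∩ ball 0 1) + volume (F.1 \ ball 0 1) = ω := fun F => by
    rw [measure_inter_add_sdiff _ measurableSet_ball, F.2.2.1]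
  have hout : ∀ F : G, volume (F.1 ∩ ball 0 1) + volume (ball 0 1 \ F.1) = ω := fun F => by
    rw [Set.inter_comm, measure_inter_add_sdiff _ F.2.1]
  set s := ⨆ F : G, volume (F.1 ∩ ball 0 1) with hs
  have hsω : s ≤ ω := iSup_le fun F => measure_mono Set.inter_subset_right
  have hst : s ≠ ∞ := ne_top_of_le_ne_top hωt hsω
  have hseq : s = ω := by
    by_contra hne
    have hm : ω - s ≠ 0 := (tsub_pos_of_lt (lt_of_le_of_ne hsω hne)).ne'
    obtain ⟨φ, hφ, hover⟩ := exists_mirror_overlap (N := N) R hm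
    have hstep : ∀ F : G, volume (F.1 ∩ ball 0 1) + φ ≤ s := fun F => by
      have hle : volume (F.1 ∩ ball 0 1) ≤ s := le_iSup (fun F : G => volume (F.1 ∩ ball 0 1)) F
      obtain ⟨b, hb, h⟩ := hover (F.1 \ ball 0 1) (ball 0 1 \ F.1) (F.2.1.diff measurableSet_ball)
        (measurableSet_ball.diff F.2.1) (Set.sdiff_subset.trans F.2.2.2.1) Set.disjoint_sdiff_left
        Set.sdiff_subset (tsub_le_iff_left.2 ((hin F).symm.le.trans (by gcongr)))
        (tsub_le_iff_left.2 ((hout F).symm.le.trans (by gcongr)))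
      let F' : G := ⟨polarization b F.1, measurableSet_polarization b F.2.1,
        (volume_polarization hb F.2.1).trans F.2.2.1, polarization_subset_ball b F.2.2.2.1,
        F.2.2.2.2.trans (energy_le_energy_polarization hp hb F.2.1)⟩
      calc _ ≤ _ := add_le_add_right h _
        _ ≤ volume (F'.1 ∩ ball 0 1) := volume_inter_ball_add_le hb F.2.1 1
        _ ≤ s := le_iSup (fun F : G => volume (F.1 ∩ ball 0 1)) F'
    have h2 : s + φ ≤ s + 0 := by
      rw [add_zero, hs, ENNReal.iSup_add]
      exact iSup_le hstep
    exact hφ (by simpa using (ENNReal.add_le_add_iff_left hst).1 h2)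
  set K := (kernelMass N p + ω) + (kernelMass N p + ω) with hK
  have hKt : K ≠ ∞ := by
    have := (kernelMass_lt_top hN hpN).ne
    simp [hK, this, hωt]
  have hF : ∀ F : G, energy p A + K * volume (F.1 ∩ ball 0 1) ≤
      energy p (ball (0 : Euc N) 1) + K * ω := fun F => by
    have h1 := energy_le_add hp F.1 (ball (0 : Euc N) 1)
    rw [F.2.2.1] at h1
    calc _ ≤ energy p (ball (0 : Euc N) 1) + K * volume (F.1 \ ball 0 1) +
          K * volume (F.1 ∩ ball 0 1) := by
          gcongr
          exact F.2.2.2.2.trans h1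
      _ = _ := by rw [add_assoc, ← mul_add, add_comm (volume (F.1 \ ball 0 1)), hin]
  have hfinal : energy p A + K * ω ≤ energy p (ball (0 : Euc N) 1) + K * ω := by
    conv_lhs => rw [← hseq]
    rw [hs, ENNReal.mul_iSup, ENNReal.add_iSup]
    exact iSup_le hF
  exact (ENNReal.add_le_add_iff_right (ENNReal.mul_ne_top hKt hωt)).1 hfinal

lemma pot_preimage_add (p : ℝ) (A : Set (Euc N)) (w x : Euc N) :
    pot p ((· + w) ⁻¹' A) x = pot p A (x + w) := by
  have h := (measurePreserving_add_right (volume : Measure (Euc N))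
    w).setLIntegral_comp_preimage_emb (measurableEmbedding_addRight w)
    (fun y => ‖y - (x + w)‖ₑ ^ (-p)) A
  simpa only [add_sub_add_right_eq_sub, pot] using h

lemma energy_preimage_add (p : ℝ) (A : Set (Euc N)) (w : Euc N) :
    energy p ((· + w) ⁻¹' A) = energy p A := by
  simp only [energy, pot_preimage_add]
  exact (measurePreserving_add_right (volume : Measure (Euc N))
    w).setLIntegral_comp_preimage_emb (measurableEmbedding_addRight w) _ _

lemma integrableOn_id_of_subset_ball {A : Set (Euc N)} {R : ℝ} (hAR : A ⊆ ball 0 R) :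
    IntegrableOn (fun x => x) A (volume : Measure (Euc N)) :=
  (continuous_id.locallyIntegrable.integrableOn_isCompact
    (isCompact_closedBall (0 : Euc N) R)).mono_set (hAR.trans ball_subset_closedBall)

lemma integral_side {A : Set (Euc N)} {R : ℝ} (hAR : A ⊆ ball 0 R) (b : Euc N) :
    ∫ x in A, side b x = ‖b‖ ^ 2 * volume.real A - inner ℝ b (∫ x in A, x) := by
  have hfin : volume A < ∞ := (measure_mono hAR).trans_lt measure_ball_lt_top
  have hi := integrableOn_id_of_subset_ball hAR
  have hc : IntegrableOn (fun _ : Euc N => ‖b‖ ^ 2) A := integrableOn_const hfin.ne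
  unfold side
  rw [integral_sub hc (hi.const_inner b), setIntegral_const, integral_inner hi, smul_eq_mul,
    mul_comm]

/-- If almost no point of `A` is separated from a mirror image outside `A`, then the barycenter of
`A` lies beyond the mirror. -/
lemma integral_side_nonpos {b : Euc N} (hb : b ≠ 0) {A : Set (Euc N)} (hA : MeasurableSet A)
    {R : ℝ} (hAR : A ⊆ ball 0 R)
    (h : volume {x | 0 < side b x ∧ x ∈ A ∧ mirror b x ∉ A} = 0) :
    ∫ x in A, side b x ≤ 0 := by
  have hfin : volume A < ∞ := (measure_mono hAR).trans_lt measure_ball_lt_top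
  have hint : IntegrableOn (side b) A :=
    (integrableOn_const hfin.ne).sub ((integrableOn_id_of_subset_ball hAR).const_inner b)
  have hmp := measurePreserving_mirror b
  have hI := (integrable_indicator_iff hA).2 hint
  rw [← integral_indicator hA]
  have e := hmp.integral_comp (isometry_mirror b).isClosedEmbedding.measurableEmbedding
    (A.indicator (side b))
  have hI2 : Integrable fun x => A.indicator (side b) (mirror b x) :=
    hmp.integrable_comp_of_integrable hI
  have h1 : ∀ᵐ x : Euc N, ¬ (0 < side b x ∧ x ∈ A ∧ mirror b x ∉ A) := by
    rw [ae_iff]; simpa using h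
  have h2 := hmp.quasiMeasurePreserving.ae h1
  have hle : ∫ x, (A.indicator (side b) x + A.indicator (side b) (mirror b x)) ≤ 0 := by
    refine integral_nonpos_of_ae ?_
    filter_upwards [h1, h2] with x hx1 hx2
    rw [side_mirror hb, mirror_mirror hb] at hx2
    by_cases c1 : x ∈ A <;> by_cases c2 : mirror b x ∈ A <;>
      simp [c1, c2, side_mirror hb] at hx1 hx2 ⊢ <;> assumption
  rw [integral_add hI hI2, e] at hle
  linarith

/-- The only centered maximizer of the Riesz energy is the unit ball. -/
lemma volume_ball_diff_eq_zero (hN : 1 ≤ N) (hp : 0 < p) (hpN : p < N) {A : Set (Euc N)}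
    (hA : MeasurableSet A) (hvol : volume A = volume (ball (0 : Euc N) 1)) {R : ℝ}
    (hAR : A ⊆ ball 0 R) (hcent : ∫ x in A, x = 0)
    (hmax : energy p (ball (0 : Euc N) 1) ≤ energy p A) : volume (ball 0 1 \ A) = 0 := by
  by_contra hm
  have hfin : volume A < ∞ := hvol ▸ measure_ball_lt_top
  have hvd : volume (ball 0 1 \ A) ≤ volume (A \ ball 0 1) := by
    have h1 := measure_inter_add_sdiff (μ := volume) A
      (measurableSet_ball (x := (0 : Euc N)) (ε := 1))
    have h2 := measure_inter_add_sdiff (μ := volume) (ball (0 : Euc N) 1) hA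
    rw [Set.inter_comm, ← hvol, ← h1] at h2
    exact ((ENNReal.add_right_inj
      ((measure_mono Set.inter_subset_left).trans_lt hfin).ne).1 h2).le
  obtain ⟨φ, hφ, hover⟩ := exists_mirror_overlap (N := N) R hm
  obtain ⟨b, hb, hY⟩ := hover (A \ ball 0 1) (ball 0 1 \ A) (hA.diff measurableSet_ball)
    (measurableSet_ball.diff hA) (Set.sdiff_subset.trans hAR) Set.disjoint_sdiff_left
    Set.sdiff_subset hvd le_rfl
  have hpol : energy p (polarization b A) ≤ energy p A :=
    (energy_le_energy_ball hN hp.le hpN (measurableSet_polarization b hA)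
      ((volume_polarization hb hA).trans hvol) (polarization_subset_ball b hAR)).trans hmax
  rcases volume_eq_zero_or_of_energy_polarization_le hp hb hA
    (energy_lt_top hN hp.le hpN hfin).ne hpol with h | h
  · have h1 := integral_side_nonpos hb hA hAR h
    rw [integral_side hAR, hcent, inner_zero_right, sub_zero, measureReal_def, hvol] at h1
    have h2 : 0 < (volume (ball (0 : Euc N) 1)).toReal :=
      ENNReal.toReal_pos (measure_ball_pos _ _ one_pos).ne' measure_ball_lt_top.ne
    have h3 : 0 < ‖b‖ := norm_pos_iff.2 hb
    have : 0 < ‖b‖ ^ 2 * (volume (ball (0 : Euc N) 1)).toReal := by positivity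
    linarith
  · refine hφ (le_antisymm (hY.trans ((measure_mono fun y hy => ?_).trans h.le)) (by simp))
    obtain ⟨⟨hy1, hy2⟩, hy3, hy4⟩ := hy
    refine ⟨?_, hy2, hy3⟩
    by_contra hneg
    have h5 : 0 ≤ side b (mirror b y) := by rw [side_mirror hb]; linarith
    have h6 := norm_le_norm_mirror h5
    rw [mirror_mirror hb] at h6
    simp only [mem_ball, dist_zero_right, not_lt] at hy1 hy4
    linarith

/-- Maximizers of the Riesz energy are unit balls. -/
theorem exists_volume_symmDiff_eq_zero (hN : 1 ≤ N) (hp : 0 < p) (hpN : p < N) {A : Set (Euc N)}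
    (hA : MeasurableSet A) (hvol : volume A = volume (ball (0 : Euc N) 1)) {R : ℝ}
    (hAR : A ⊆ ball 0 R) (hmax : energy p (ball (0 : Euc N) 1) ≤ energy p A) :
    ∃ w : Euc N, volume (ball w 1 ∆ A) = 0 := by
  have hfin : volume A < ∞ := hvol ▸ measure_ball_lt_top
  have hpos : 0 < volume.real A := by
    rw [measureReal_def, hvol]
    exact ENNReal.toReal_pos (measure_ball_pos _ _ one_pos).ne' measure_ball_lt_top.ne
  set w : Euc N := (volume.real A)⁻¹ • ∫ x in A, x with hw
  have hmp := measurePreserving_add_right (volume : Measure (Euc N)) w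
  have hemb := measurableEmbedding_addRight w
  set A₀ := (· + w) ⁻¹' A with hA₀
  have hA₀m : MeasurableSet A₀ := hmp.measurable hA
  have hA₀v : volume A₀ = volume A := hmp.measure_preimage_emb hemb A
  have hA₀R : A₀ ⊆ ball 0 (R + ‖w‖) := fun x hx => by
    have : ‖x + w‖ < R := by simpa using hAR hx
    have h2 : ‖x‖ ≤ ‖x + w‖ + ‖w‖ := by simpa using norm_sub_le (x + w) w
    simpa using (by linarith : ‖x‖ < R + ‖w‖)
  have hcent : ∫ x in A₀, x = 0 := by
    have := hmp.setIntegral_preimage_emb hemb (fun x => x - w) A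
    simp only [add_sub_cancel_right] at this
    rw [hA₀, this, integral_sub (integrableOn_id_of_subset_ball hAR) (integrableOn_const hfin.ne),
      setIntegral_const, hw, smul_smul, mul_inv_cancel₀ hpos.ne', one_smul, sub_self]
  have h1 := volume_ball_diff_eq_zero hN hp hpN hA₀m (hA₀v.trans hvol) hA₀R hcent
    (by rwa [hA₀, energy_preimage_add])
  have h2 : volume (A₀ \ ball 0 1) = 0 := by
    have e1 := measure_inter_add_sdiff (μ := volume) A₀
      (measurableSet_ball (x := (0 : Euc N)) (ε := 1))
    have e2 := measure_inter_add_sdiff (μ := volume) (ball (0 : Euc N) 1) hA₀m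
    rw [h1, add_zero, Set.inter_comm, ← hvol, ← hA₀v] at e2
    rw [e2] at e1
    simpa using (ENNReal.add_right_inj (c := 0) (hA₀v ▸ hfin.ne)).1 (e1.trans (add_zero _).symm)
  refine ⟨w, ?_⟩
  rw [← hmp.measure_preimage_emb hemb]
  have : (· + w) ⁻¹' (ball w 1 ∆ A) = ball 0 1 ∆ A₀ := by
    ext x
    simp [Set.mem_symmDiff, hA₀]
  rw [this, Set.symmDiff_def]
  exact measure_union_null h1 h2

/-- A tangent line inequality for the convex function `a ↦ a ^ (-p)`. -/
lemma rpow_neg_add_le (hp : 0 ≤ p) {a b : ℝ} (ha : 0 < a) (hb : 0 < b) :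
    b ^ (-p) + p * (b - a) * b ^ (-(p + 1)) ≤ a ^ (-p) := by
  have hr : 0 < a / b := div_pos ha hb
  have h1 : 1 - p * (a / b - 1) ≤ (a / b) ^ (-p) := by
    rw [Real.rpow_def_of_pos hr]
    have h2 := Real.add_one_le_exp (Real.log (a / b) * -p)
    have h3 := mul_le_mul_of_nonneg_left (Real.log_le_sub_one_of_pos hr) hp
    linarith
  have h4 : a ^ (-p) = b ^ (-p) * (a / b) ^ (-p) := by
    rw [← Real.mul_rpow hb.le hr.le, mul_div_cancel₀ _ hb.ne']
  have h5 : b ^ (-(p + 1)) = b ^ (-p) / b := by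
    rw [neg_add, Real.rpow_add hb, Real.rpow_neg_one, div_eq_mul_inv]
  rw [h4, h5]
  calc _ = b ^ (-p) * (1 - p * (a / b - 1)) := by field_simp; ring
    _ ≤ _ := by gcongr

lemma norm_sub_smul_sq {θ : Euc N} (hθ : ‖θ‖ = 1) (y : Euc N) (t : ℝ) :
    ‖y - t • θ‖ ^ 2 = ‖y‖ ^ 2 - 2 * t * inner ℝ y θ + t ^ 2 := by
  rw [norm_sub_sq_real, inner_smul_right, norm_smul, hθ, mul_one, Real.norm_eq_abs, sq_abs]
  ring

/-- The potential of a set grows at most by its potential with exponent `p + 1`. -/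
lemma pot_le_add_pot (hN : 1 ≤ N) (hp : 0 ≤ p) (A : Set (Euc N)) {θ : Euc N} (hθ : ‖θ‖ = 1)
    {s t : ℝ} (hst : s ≤ t) :
    pot p A (t • θ) ≤ pot p A (s • θ) + ENNReal.ofReal (p * (t - s)) * pot (p + 1) A (t • θ) := by
  have hm : ∀ (q : ℝ) (x : Euc N), Measurable fun y : Euc N => ‖y - x‖ₑ ^ q :=
    fun q x => by fun_prop
  rw [pot, pot, pot, ← lintegral_const_mul _ (hm _ _), ← lintegral_add_left (hm _ _)]
  refine lintegral_mono_ae (ae_restrict_of_ae ?_)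
  filter_upwards [ae_ne_point hN (s • θ), ae_ne_point hN (t • θ)] with y hs ht
  have hs' := sub_ne_zero.2 hs
  have ht' := sub_ne_zero.2 ht
  have hps := norm_pos_iff.2 hs'
  have hpt := norm_pos_iff.2 ht'
  rw [enorm_rpow_eq_ofReal hs', enorm_rpow_eq_ofReal ht', enorm_rpow_eq_ofReal ht',
    ← ENNReal.ofReal_mul (by have := sub_nonneg.2 hst; positivity),
    ← ENNReal.ofReal_add (by positivity) (by have := sub_nonneg.2 hst; positivity)]
  refine ENNReal.ofReal_le_ofReal ?_
  have h1 := rpow_neg_add_le hp hps hpt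
  have h2 : ‖y - s • θ‖ - ‖y - t • θ‖ ≤ t - s := by
    refine (norm_sub_norm_le _ _).trans_eq ?_
    rw [sub_sub_sub_cancel_left, ← sub_smul, norm_smul, hθ, mul_one, Real.norm_of_nonneg]
    linarith
  have h3 : 0 ≤ p * ‖y - t • θ‖ ^ (-(p + 1)) := by positivity
  nlinarith [mul_le_mul_of_nonneg_left h2 h3]

/-- The potential of a ball strictly decreases along rays outside of the ball. -/
lemma pot_ball_add_le (hp : 0 < p) {r : ℝ} (hr : 1 / 2 ≤ r) {θ : Euc N}
    (hθ : ‖θ‖ = 1) {s t : ℝ} (hs : r ≤ s) (hst : s ≤ t) (ht : t ≤ 3 / 2) :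
    pot p (ball 0 r) (t • θ) +
        ENNReal.ofReal (p / 8 * 2 ^ (-(p + 1)) * (t - s)) * volume (ball (0 : Euc N) (1 / 4)) ≤
      pot p (ball 0 r) (s • θ) := by
  set κ : ℝ := p / 8 * 2 ^ (-(p + 1)) with hκ
  have hsub : ball (0 : Euc N) (1 / 4) ⊆ ball 0 r := ball_subset_ball (by linarith)
  have e : ENNReal.ofReal (κ * (t - s)) * volume (ball (0 : Euc N) (1 / 4)) =
      ∫⁻ y in ball (0 : Euc N) r,
        (ball (0 : Euc N) (1 / 4)).indicator (fun _ => ENNReal.ofReal (κ * (t - s))) y := by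
    rw [lintegral_indicator measurableSet_ball, Measure.restrict_restrict measurableSet_ball,
      Set.inter_eq_left.2 hsub, setLIntegral_const]
  rw [e, pot, pot, ← lintegral_add_left (by fun_prop)]
  refine setLIntegral_mono (by fun_prop) fun y hy => ?_
  have hy1 : ‖y‖ < r := by simpa using hy
  have hne : ∀ u, r ≤ u → y - u • θ ≠ 0 := fun u hu h => by
    rw [sub_eq_zero] at h
    have : ‖y‖ = |u| := by rw [h, norm_smul, hθ, mul_one, Real.norm_eq_abs]
    have := le_abs_self u
    linarith
  have ha := norm_pos_iff.2 (hne s hs)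
  have hb := norm_pos_iff.2 (hne t (hs.trans hst))
  rw [enorm_rpow_eq_ofReal (hne s hs), enorm_rpow_eq_ofReal (hne t (hs.trans hst))]
  have ea := norm_sub_smul_sq hθ y s
  have eb := norm_sub_smul_sq hθ y t
  have hin : inner ℝ y θ ≤ ‖y‖ := by simpa [hθ] using real_inner_le_norm y θ
  have hmain := rpow_neg_add_le hp.le ha hb
  set a := ‖y - s • θ‖
  set b := ‖y - t • θ‖
  have hab : a ≤ b := by
    refine le_of_sq_le_sq ?_ hb.le
    nlinarith
  have hbp : 0 < b ^ (-(p + 1)) := by positivity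
  by_cases hy4 : y ∈ ball (0 : Euc N) (1 / 4)
  · rw [Set.indicator_of_mem hy4, ← ENNReal.ofReal_add (by positivity)
      (by have := sub_nonneg.2 hst; positivity)]
    refine ENNReal.ofReal_le_ofReal (le_trans ?_ hmain)
    have hy5 : ‖y‖ < 1 / 4 := by simpa using hy4
    have hb2 : b ≤ 2 := by
      have h1 : b ≤ ‖y‖ + ‖t • θ‖ := norm_sub_le _ _
      rw [norm_smul, hθ, mul_one, Real.norm_of_nonneg (by linarith)] at h1
      linarith
    have hgap : (t - s) / 8 ≤ b - a := by
      have h1 : (b - a) * (b + a) = (t - s) * (t + s - 2 * inner ℝ y θ) := by nlinarith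
      have h2 : (t - s) * (1 / 2) ≤ (t - s) * (t + s - 2 * inner ℝ y θ) :=
        mul_le_mul_of_nonneg_left (by linarith) (by linarith)
      have h3 : (b - a) * (b + a) ≤ (b - a) * 4 :=
        mul_le_mul_of_nonneg_left (by linarith) (by linarith)
      linarith
    have hpow : (2 : ℝ) ^ (-(p + 1)) ≤ b ^ (-(p + 1)) :=
      Real.rpow_le_rpow_of_nonpos hb hb2 (by linarith)
    have h2p : (0 : ℝ) < 2 ^ (-(p + 1)) := by positivity
    have : κ * (t - s) ≤ p * (b - a) * b ^ (-(p + 1)) := by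
      calc κ * (t - s) = p * ((t - s) / 8) * 2 ^ (-(p + 1)) := by rw [hκ]; ring
        _ ≤ p * (b - a) * b ^ (-(p + 1)) := by
          gcongr
    linarith
  · rw [Set.indicator_of_notMem hy4, add_zero]
    refine ENNReal.ofReal_le_ofReal (le_trans ?_ hmain)
    have : 0 ≤ p * (b - a) * b ^ (-(p + 1)) :=
      mul_nonneg (mul_nonneg hp.le (by linarith)) hbp.le
    linarith

lemma exists_volume_annulus_lt (hN : 1 ≤ N) {δ : ℝ≥0∞} (hδ : 0 < δ) :
    ∃ ε₀ : ℝ, 0 < ε₀ ∧ ε₀ ≤ 1 / 2 ∧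
      volume (closedBall (0 : Euc N) (1 + ε₀) \ ball 0 (1 - ε₀)) < δ := by
  have : Nonempty (Fin N) := ⟨⟨0, hN⟩⟩
  have hc : Continuous fun ε : ℝ => ENNReal.ofReal ((1 + ε) ^ N - (1 - ε) ^ N) *
      volume (ball (0 : Euc N) 1) :=
    ENNReal.continuous_mul_const measure_ball_lt_top.ne |>.comp
      (ENNReal.continuous_ofReal.comp (by fun_prop))
  have h0 := (hc.tendsto 0).eventually_lt_const (u := δ) (by simpa using hδ)
  have h1 := (h0.filter_mono nhdsWithin_le_nhds).and
    (Ioo_mem_nhdsGT (show (0 : ℝ) < 1 / 2 by norm_num))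
  obtain ⟨ε, hε, hε0, hε1⟩ := h1.exists
  refine ⟨ε, hε0, hε1.le, lt_of_eq_of_lt ?_ hε⟩
  rw [measure_sdiff (ball_subset_closedBall.trans (closedBall_subset_closedBall (by linarith)))
    measurableSet_ball.nullMeasurableSet measure_ball_lt_top.ne,
    Measure.addHaar_closedBall _ _ (by linarith), Measure.addHaar_ball _ (0 : Euc N) (r := 1 - ε)
    (by linarith),
    finrank_euclideanSpace_fin, ← ENNReal.sub_mul (fun _ _ => measure_ball_lt_top.ne),
    ENNReal.ofReal_sub _ (by have : 0 < 1 - ε := by linarith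
                             positivity)]

/-- The potential of a set close to the unit ball decreases along rays close to the unit sphere, at
a definite rate. -/
theorem exists_pot_slope (hp : 0 < p) (hpN : p + 1 < N) :
    ∃ ε₀ : ℝ, 0 < ε₀ ∧ ε₀ ≤ 1 / 2 ∧ ∃ c : ℝ, 0 < c ∧ ∀ ε : ℝ, 0 < ε → ε < ε₀ →
      ∀ E : Set (Euc N), ball 0 (1 - ε) ⊆ E → E ⊆ closedBall 0 (1 + ε) →
      ∀ θ : Euc N, ‖θ‖ = 1 → ∀ s t : ℝ, 1 - ε ≤ s → s ≤ t → t ≤ 1 + ε →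
      pot p E (t • θ) + ENNReal.ofReal (c * (t - s)) ≤ pot p E (s • θ) := by
  have hN : 1 ≤ N := by
    have : (1 : ℝ) < N := by linarith
    exact_mod_cast this.le
  set v := (volume (ball (0 : Euc N) (1 / 4))).toReal with hv
  have hv0 : 0 < v :=
    ENNReal.toReal_pos (measure_ball_pos _ _ (by norm_num)).ne' measure_ball_lt_top.ne
  set κ : ℝ := p / 8 * 2 ^ (-(p + 1)) with hκ
  have hκ0 : 0 < κ := by positivity
  set c := κ * v / 2 with hc
  have hc0 : 0 < c := by positivity
  obtain ⟨δ, hδ, hpot⟩ := exists_pot_le_of_volume_lt hN (by linarith : 0 ≤ p + 1) hpN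
    (η := ENNReal.ofReal (c / p)) (by simpa using div_pos hc0 hp)
  obtain ⟨ε₀, hε₀, hε₁, hvol⟩ := exists_volume_annulus_lt hN hδ
  refine ⟨ε₀, hε₀, hε₁, c, hc0, fun ε hε hε' E hE1 hE2 θ hθ s t hs hst ht => ?_⟩
  have hts : 0 ≤ t - s := sub_nonneg.2 hst
  have hsplit : ∀ x, pot p E x = pot p (ball 0 (1 - ε)) x + pot p (E \ ball 0 (1 - ε)) x :=
      fun x => by
    rw [pot, pot, pot, ← lintegral_inter_add_sdiff _ E (measurableSet_ball (x := 0) (ε := 1 - ε)),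
      Set.inter_eq_right.2 hE1]
  have hann : pot (p + 1) (E \ ball 0 (1 - ε)) (t • θ) ≤ ENNReal.ofReal (c / p) := by
    refine hpot _ ((measure_mono ?_).trans_lt hvol) _
    exact Set.sdiff_subset_sdiff (hE2.trans (closedBall_subset_closedBall (by linarith)))
      (ball_subset_ball (by linarith))
  have h1 := pot_le_add_pot hN hp.le (E \ ball 0 (1 - ε)) hθ hst
  have h2 := pot_ball_add_le hp (by linarith : 1 / 2 ≤ 1 - ε) hθ hs hst (by linarith)
  have h3 : ENNReal.ofReal (p * (t - s)) * pot (p + 1) (E \ ball 0 (1 - ε)) (t • θ) ≤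
      ENNReal.ofReal (c * (t - s)) := by
    calc _ ≤ ENNReal.ofReal (p * (t - s)) * ENNReal.ofReal (c / p) := by gcongr
      _ = _ := by
        rw [← ENNReal.ofReal_mul (by positivity)]
        congr 1
        field_simp
  have h4 : ENNReal.ofReal (κ * (t - s)) * volume (ball (0 : Euc N) (1 / 4)) =
      ENNReal.ofReal (c * (t - s)) + ENNReal.ofReal (c * (t - s)) := by
    rw [← ENNReal.ofReal_toReal (a := volume (ball (0 : Euc N) (1 / 4))) measure_ball_lt_top.ne,
      ← ENNReal.ofReal_mul (by positivity), ← ENNReal.ofReal_add (by positivity) (by positivity)]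
    congr 1
    rw [hc, hv]; ring
  rw [h4] at h2
  calc _ ≤ pot p (ball 0 (1 - ε)) (t • θ) + (pot p (E \ ball 0 (1 - ε)) (s • θ) +
          ENNReal.ofReal (c * (t - s))) + ENNReal.ofReal (c * (t - s)) := by
          rw [hsplit]
          gcongr
          exact h1.trans (by gcongr)
      _ = (pot p (ball 0 (1 - ε)) (t • θ) + (ENNReal.ofReal (c * (t - s)) +
          ENNReal.ofReal (c * (t - s)))) + pot p (E \ ball 0 (1 - ε)) (s • θ) := by ring
      _ ≤ _ := by rw [hsplit (s • θ)]; gcongr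

/-- The radial part of Lebesgue measure in polar coordinates, with density `r ^ (N - 1)` on
`(0, ∞)`. -/
noncomputable def radial (N : ℕ) : Measure ℝ :=
  (Measure.volumeIoiPow (N - 1)).map Subtype.val

instance : SFinite (radial N) := by
  unfold radial
  infer_instance

lemma radial_apply {s : Set ℝ} (hs : MeasurableSet s) :
    radial N s = Measure.volumeIoiPow (N - 1) (Subtype.val ⁻¹' s) :=
  Measure.map_apply measurable_subtype_coe hs

lemma ae_radial_pos : ∀ᵐ r ∂radial N, 0 < r := by
  rw [ae_iff, radial_apply (s := {r | ¬ 0 < r})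
    (measurableSet_lt measurable_const measurable_id).compl]
  convert measure_empty (μ := Measure.volumeIoiPow (N - 1))
  exact Set.eq_empty_of_forall_notMem fun r hr => hr r.2

lemma radial_Iio (hN : 1 ≤ N) {x : ℝ} (hx : 0 ≤ x) :
    radial N (Set.Iio x) = ENNReal.ofReal (x ^ N / N) := by
  rcases hx.eq_or_lt with rfl | hx
  · have h : radial N (Set.Iio 0) ≤ radial N {r | ¬ 0 < r} :=
      measure_mono fun r hr => not_lt.2 (Set.mem_Iio.1 hr).le
    rw [ae_iff.1 ae_radial_pos] at h
    rw [le_antisymm h (by simp), zero_pow (by omega)]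
    simp
  · have h := Measure.volumeIoiPow_apply_Iio (N - 1) ⟨x, hx⟩
    have e : ((N - 1 : ℕ) : ℝ) + 1 = N := by rw [Nat.cast_sub hN]; simp
    rw [e, Nat.sub_add_cancel hN] at h
    rw [radial_apply measurableSet_Iio, ← h]
    rfl

lemma radial_singleton (x : ℝ) : radial N {x} = 0 := by
  rw [radial_apply (measurableSet_singleton x)]
  refine withDensity_absolutelyContinuous _ _ ?_
  rw [(MeasurableEmbedding.subtype_coe measurableSet_Ioi).comap_apply]
  exact measure_mono_null (Set.image_preimage_subset _ _) (by simp)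

lemma radial_Iic (x : ℝ) : radial N (Set.Iic x) = radial N (Set.Iio x) := by
  refine le_antisymm ?_ (measure_mono Set.Iio_subset_Iic_self)
  rw [← Set.Iio_union_right]
  exact (measure_union_le _ _).trans (by rw [radial_singleton, add_zero])

lemma radial_Ico_le (hN : 1 ≤ N) {a b : ℝ} (ha : 0 ≤ a) (hab : a ≤ b) (hb : b ≤ 2) :
    radial N (Set.Ico a b) ≤ ENNReal.ofReal (2 ^ (N - 1) * (b - a)) := by
  have hb0 := ha.trans hab
  rw [← Set.Iio_sdiff_Iio, measure_sdiff (Set.Iio_subset_Iio hab)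
    measurableSet_Iio.nullMeasurableSet (by simp [radial_Iio hN ha]), radial_Iio hN ha,
    radial_Iio hN hb0, ← ENNReal.ofReal_sub _ (by positivity)]
  refine ENNReal.ofReal_le_ofReal ?_
  have hN0 : (0 : ℝ) < N := by exact_mod_cast hN
  rw [← sub_div, div_le_iff₀ hN0]
  have h := (le_abs_self _).trans (abs_pow_sub_pow_le b a N)
  rw [abs_of_nonneg (sub_nonneg.2 hab), abs_of_nonneg hb0, abs_of_nonneg ha, max_eq_left hab] at h
  refine h.trans ?_
  have h2 : b ^ (N - 1) ≤ 2 ^ (N - 1) := by gcongr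
  have h3 : 0 ≤ (b - a) * N := mul_nonneg (sub_nonneg.2 hab) hN0.le
  nlinarith [mul_le_mul_of_nonneg_left h2 h3]

/-- Integration in polar coordinates. -/
lemma lintegral_polar (hN : 1 ≤ N) {f : Euc N → ℝ≥0∞} (hf : Measurable f) :
    ∫⁻ x, f x = ∫⁻ θ : sphere (0 : Euc N) 1, ∫⁻ r, f (r • (θ : Euc N)) ∂radial N
      ∂(volume : Measure (Euc N)).toSphere := by
  have : Nonempty (Fin N) := ⟨⟨0, hN⟩⟩
  have hmp := (volume : Measure (Euc N)).measurePreserving_homeomorphUnitSphereProd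
  have hg : Measurable fun z : sphere (0 : Euc N) 1 × Set.Ioi (0 : ℝ) =>
      f ((z.2 : ℝ) • (z.1 : Euc N)) := by fun_prop
  have h := hmp.lintegral_comp hg
  rw [lintegral_prod _ hg.aemeasurable, finrank_euclideanSpace_fin] at h
  have hr : ∀ θ : sphere (0 : Euc N) 1, ∫⁻ r, f (r • (θ : Euc N)) ∂radial N =
      ∫⁻ r : Set.Ioi (0 : ℝ), f ((r : ℝ) • (θ : Euc N)) ∂Measure.volumeIoiPow (N - 1) := fun θ => by
    rw [radial, lintegral_map (by fun_prop) measurable_subtype_coe]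
  simp only [hr]
  have hres : ∫⁻ x, f x = ∫⁻ x in {(0 : Euc N)}ᶜ, f x := by rw [restrict_compl_singleton]
  rw [← h, hres, ← lintegral_subtype_comap (measurableSet_singleton _).compl]
  refine lintegral_congr fun x => ?_
  have hx : ‖(x : Euc N)‖ ≠ 0 := norm_ne_zero_iff.2 x.2
  simp [smul_smul, hx]

lemma volume_polar (hN : 1 ≤ N) {A : Set (Euc N)} (hA : MeasurableSet A) :
    volume A = ∫⁻ θ : sphere (0 : Euc N) 1, radial N {r | r • (θ : Euc N) ∈ A}
      ∂(volume : Measure (Euc N)).toSphere := by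
  rw [← lintegral_indicator_one hA, lintegral_polar hN (measurable_one.indicator hA)]
  refine lintegral_congr fun θ => ?_
  have h : MeasurableSet {r : ℝ | r • (θ : Euc N) ∈ A} := measurable_smul_const _ hA
  rw [← lintegral_indicator_one h]
  rfl

lemma setLIntegral_polar (hN : 1 ≤ N) {A : Set (Euc N)} (hA : MeasurableSet A) {f : Euc N → ℝ≥0∞}
    (hf : Measurable f) :
    ∫⁻ x in A, f x = ∫⁻ θ : sphere (0 : Euc N) 1,
      (∫⁻ r in {r | r • (θ : Euc N) ∈ A}, f (r • (θ : Euc N)) ∂radial N)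
      ∂(volume : Measure (Euc N)).toSphere := by
  rw [← lintegral_indicator hA, lintegral_polar hN (hf.indicator hA)]
  refine lintegral_congr fun θ => ?_
  have h : MeasurableSet {r : ℝ | r • (θ : Euc N) ∈ A} := measurable_smul_const _ hA
  rw [← lintegral_indicator h]
  rfl

/-- The star-shaped set with radial function `ρ`. -/
def openStar (ρ : Euc N → ℝ) : Set (Euc N) := {x | ‖x‖ < ρ (‖x‖⁻¹ • x)}

lemma measurableSet_openStar {ρ : Euc N → ℝ} (hρ : Measurable ρ) : MeasurableSet (openStar ρ) :=
  measurableSet_lt measurable_norm (hρ.comp (by fun_prop))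

lemma smul_mem_openStar {ρ : Euc N → ℝ} {θ : Euc N} (hθ : ‖θ‖ = 1) {r : ℝ} (hr : 0 < r) :
    r • θ ∈ openStar ρ ↔ r < ρ θ := by
  simp [openStar, norm_smul, hθ, abs_of_pos hr, smul_smul, hr.ne']

/-- A quantitative one-dimensional rearrangement inequality for a function `w` that crosses the
level `W` at `ρ` with a definite slope. -/
lemma setLIntegral_add_le_of_slope {μ : Measure ℝ} {U V : Set ℝ} (hU : MeasurableSet U)
    (hV : MeasurableSet V) (hUV : μ U = μ V) (hfin : μ V ≠ ∞) {w : ℝ → ℝ≥0∞} (hw : Measurable w)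
    {W : ℝ≥0∞} {c ρ τ : ℝ} (hc : 0 ≤ c)
    (h1 : ∀ᵐ r ∂μ, r ∈ V \ U → W + ENNReal.ofReal (c * (ρ - r)) ≤ w r)
    (h2 : ∀ᵐ r ∂μ, r ∈ U \ V → w r + ENNReal.ofReal (c * (r - ρ)) ≤ W)
    (hVr : ∀ᵐ r ∂μ, r ∈ V → r ≤ ρ) (hUr : ∀ᵐ r ∂μ, r ∈ U \ V → ρ ≤ r)
    {κ : ℝ≥0∞} (hκ : μ (U ∆ V ∩ {r | |r - ρ| < τ}) ≤ κ) :
    (∫⁻ r in U, w r ∂μ) + ENNReal.ofReal (c * τ) * μ (U ∆ V) ≤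
      (∫⁻ r in V, w r ∂μ) + ENNReal.ofReal (c * τ) * κ := by
  set T : Set ℝ := {r | |r - ρ| < τ} with hT
  have hTm : MeasurableSet T := measurableSet_lt (by fun_prop) measurable_const
  set k := ENNReal.ofReal (c * τ) with hk
  have hD : μ (V \ U) = μ (U \ V) := by
    have e1 := measure_inter_add_sdiff (μ := μ) V hU
    have e2 := measure_inter_add_sdiff (μ := μ) U hV
    rw [Set.inter_comm, hUV, ← e1] at e2
    exact ((ENNReal.add_right_inj (ne_top_of_le_ne_top hfin
      (measure_mono Set.inter_subset_left))).1 e2).symm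
  have hTc : ∀ r, r ∉ T → τ ≤ |r - ρ| := fun r hr => not_lt.1 hr
  have a1 : W * μ (V \ U) + k * μ ((V \ U) \ T) ≤ ∫⁻ r in V \ U, w r ∂μ := by
    have e : W * μ (V \ U) + k * μ ((V \ U) \ T) =
        ∫⁻ r in V \ U, (W + Tᶜ.indicator (fun _ => k) r) ∂μ := by
      rw [lintegral_add_left measurable_const, lintegral_indicator hTm.compl, setLIntegral_const,
        Measure.restrict_restrict hTm.compl, setLIntegral_const, Set.inter_comm, ← Set.sdiff_eq]
    rw [e]
    refine setLIntegral_mono_ae hw.aemeasurable ?_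
    filter_upwards [h1, hVr] with r hr hr' hm
    refine le_trans ?_ (hr hm)
    gcongr
    by_cases hrT : r ∈ T
    · simp [hrT]
    · rw [Set.indicator_of_mem (by exact hrT)]
      refine ENNReal.ofReal_le_ofReal (mul_le_mul_of_nonneg_left ?_ hc)
      have := hTc r hrT
      rwa [abs_of_nonpos (by linarith [hr' hm.1]), neg_sub] at this
  have a2 : (∫⁻ r in U \ V, w r ∂μ) + k * μ ((U \ V) \ T) ≤ W * μ (U \ V) := by
    have e : (∫⁻ r in U \ V, w r ∂μ) + k * μ ((U \ V) \ T) =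
        ∫⁻ r in U \ V, (w r + Tᶜ.indicator (fun _ => k) r) ∂μ := by
      rw [lintegral_add_left hw, lintegral_indicator hTm.compl,
        Measure.restrict_restrict hTm.compl, setLIntegral_const, Set.inter_comm, ← Set.sdiff_eq]
    rw [e, ← setLIntegral_const]
    refine setLIntegral_mono_ae measurable_const.aemeasurable ?_
    filter_upwards [h2, hUr] with r hr hr' hm
    refine le_trans ?_ (hr hm)
    gcongr
    by_cases hrT : r ∈ T
    · simp [hrT]
    · rw [Set.indicator_of_mem (by exact hrT)]
      refine ENNReal.ofReal_le_ofReal (mul_le_mul_of_nonneg_left ?_ hc)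
      have := hTc r hrT
      rwa [abs_of_nonneg (by linarith [hr' hm])] at this
  have a3 : μ (U ∆ V) ≤ μ ((V \ U) \ T) + μ ((U \ V) \ T) + κ := by
    have hsub : U ∆ V ⊆ ((V \ U) \ T ∪ (U \ V) \ T) ∪ (U ∆ V ∩ T) := fun r hr => by
      by_cases hrT : r ∈ T
      · exact Or.inr ⟨hr, hrT⟩
      · rcases hr with hr | hr
        · exact Or.inl (Or.inr ⟨hr, hrT⟩)
        · exact Or.inl (Or.inl ⟨hr, hrT⟩)
    refine (measure_mono hsub).trans ((measure_union_le _ _).trans ?_)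
    gcongr
    exact measure_union_le _ _
  rw [← lintegral_inter_add_sdiff w U hV, ← lintegral_inter_add_sdiff w V hU, Set.inter_comm V U]
  calc _ ≤ (∫⁻ r in U ∩ V, w r ∂μ) + (∫⁻ r in U \ V, w r ∂μ) +
        k * (μ ((V \ U) \ T) + μ ((U \ V) \ T) + κ) := by gcongr
    _ = (∫⁻ r in U ∩ V, w r ∂μ) + ((∫⁻ r in U \ V, w r ∂μ) + k * μ ((U \ V) \ T)) +
        k * μ ((V \ U) \ T) + k * κ := by ring
    _ ≤ (∫⁻ r in U ∩ V, w r ∂μ) + W * μ (U \ V) + k * μ ((V \ U) \ T) + k * κ := by gcongr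
    _ = (∫⁻ r in U ∩ V, w r ∂μ) + (W * μ (V \ U) + k * μ ((V \ U) \ T)) + k * κ := by
        rw [hD]; ring
    _ ≤ _ := by gcongr

/-- The radial function of the star-shaped set having the same mass as `E` on every ray, kept
above `1 - ε`. -/
noncomputable def radius (E : Set (Euc N)) (ε : ℝ) (x : Euc N) : ℝ :=
  max (1 - ε) ((N * (radial N {r | r • x ∈ E}).toReal) ^ ((N : ℝ)⁻¹))

lemma measurable_radius {E : Set (Euc N)} (hE : MeasurableSet E) (ε : ℝ) :
    Measurable (radius E ε) := by
  have h : MeasurableSet {z : Euc N × ℝ | z.2 • z.1 ∈ E} :=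
    (by fun_prop : Measurable fun z : Euc N × ℝ => z.2 • z.1) hE
  have h2 := measurable_measure_prodMk_left (ν := radial N) h
  unfold radius
  exact measurable_const.max ((h2.ennreal_toReal.const_mul _).pow_const _)

section

variable {E : Set (Euc N)} {ε : ℝ} {θ : Euc N}

lemma radial_section_bounds (hN : 1 ≤ N) (hε : 0 < ε) (hε1 : ε ≤ 1 / 2)
    (h1 : ball 0 (1 - ε) ⊆ E) (h2 : E ⊆ ball 0 (1 + ε)) (hθ : ‖θ‖ = 1) :
    ENNReal.ofReal ((1 - ε) ^ N / N) ≤ radial N {r | r • θ ∈ E} ∧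
      radial N {r | r • θ ∈ E} ≤ ENNReal.ofReal ((1 + ε) ^ N / N) := by
  rw [← radial_Iio hN (by linarith), ← radial_Iio hN (by linarith)]
  constructor <;> refine measure_mono_ae ?_ <;> filter_upwards [ae_radial_pos (N := N)] with r hr hm
  · refine h1 ?_
    have hm' : r < 1 - ε := hm
    simpa [norm_smul, hθ, abs_of_pos hr] using hm'
  · have := h2 hm
    change r < 1 + ε
    simpa [norm_smul, hθ, abs_of_pos hr] using this

lemma radius_spec (hN : 1 ≤ N) (hε : 0 < ε) (hε1 : ε ≤ 1 / 2)
    (h1 : ball 0 (1 - ε) ⊆ E) (h2 : E ⊆ ball 0 (1 + ε)) (hθ : ‖θ‖ = 1) :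
    1 - ε ≤ radius E ε θ ∧ radius E ε θ ≤ 1 + ε ∧
      radial N (Set.Iio (radius E ε θ)) = radial N {r | r • θ ∈ E} := by
  obtain ⟨hl, hu⟩ := radial_section_bounds hN hε hε1 h1 h2 hθ
  have hfin : radial N {r | r • θ ∈ E} ≠ ∞ := ne_top_of_le_ne_top (by simp) hu
  have hN0 : (0 : ℝ) < N := by exact_mod_cast hN
  have hε' : 0 < 1 - ε := by linarith
  rw [ENNReal.ofReal_le_iff_le_toReal hfin, div_le_iff₀ hN0] at hl
  rw [ENNReal.le_ofReal_iff_toReal_le hfin (by positivity), le_div_iff₀ hN0] at hu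
  set m := (radial N {r | r • θ ∈ E}).toReal with hm
  have hq : ((N * m) ^ ((N : ℝ)⁻¹)) ^ N = N * m :=
    Real.rpow_inv_natCast_pow (by positivity) (by omega)
  have hq0 : 0 ≤ (N * m) ^ ((N : ℝ)⁻¹) := by positivity
  have hlow : 1 - ε ≤ (N * m) ^ ((N : ℝ)⁻¹) := by
    rw [← pow_le_pow_iff_left₀ hε'.le hq0 (by omega : N ≠ 0), hq]
    linarith
  have hup : (N * m) ^ ((N : ℝ)⁻¹) ≤ 1 + ε := by
    rw [← pow_le_pow_iff_left₀ hq0 (by linarith) (by omega : N ≠ 0), hq]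
    linarith
  have e : radius E ε θ = (N * m) ^ ((N : ℝ)⁻¹) := max_eq_right hlow
  refine ⟨e ▸ hlow, e ▸ hup, ?_⟩
  rw [e, radial_Iio hN hq0, hq, mul_div_cancel_left₀ _ hN0.ne', hm, ENNReal.ofReal_toReal hfin]

end

section

variable {E : Set (Euc N)} {ε : ℝ}

lemma radial_openStar_section {ρ : Euc N → ℝ} {θ : Euc N} (hθ : ‖θ‖ = 1) :
    radial N {r | r • θ ∈ openStar ρ} = radial N (Set.Iio (ρ θ)) := by
  refine measure_congr ?_
  filter_upwards [ae_radial_pos (N := N)] with r hr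
  exact propext (smul_mem_openStar hθ hr)

lemma norm_inv_norm_smul {x : Euc N} (hx : x ≠ 0) : ‖‖x‖⁻¹ • x‖ = 1 :=
  norm_smul_inv_norm (𝕜 := ℝ) hx

lemma ball_subset_openStar {ρ : Euc N → ℝ} {r : ℝ} (hρ : ∀ x, r ≤ ρ x) : ball 0 r ⊆ openStar ρ :=
  fun x hx => (by simpa using hx : ‖x‖ < r).trans_le (hρ _)

lemma openStar_subset_closedBall {ρ : Euc N → ℝ} {r : ℝ} (hr : 0 ≤ r)
    (hρ : ∀ x, ‖x‖ = 1 → ρ x ≤ r) :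
    openStar ρ ⊆ closedBall 0 r := fun x hx => by
  rcases eq_or_ne x 0 with rfl | h0
  · simpa using hr
  · have := (show ‖x‖ < _ from hx).le.trans (hρ _ (norm_inv_norm_smul h0))
    simpa using this

lemma volume_openStar_radius (hN : 1 ≤ N) (hE : MeasurableSet E) (hε : 0 < ε) (hε1 : ε ≤ 1 / 2)
    (h1 : ball 0 (1 - ε) ⊆ E) (h2 : E ⊆ ball 0 (1 + ε)) :
    volume (openStar (radius E ε)) = volume E := by
  rw [volume_polar hN (measurableSet_openStar (measurable_radius hE ε)), volume_polar hN hE]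
  refine lintegral_congr fun θ => ?_
  have hθ : ‖(θ : Euc N)‖ = 1 := by simp
  rw [radial_openStar_section hθ, (radius_spec hN hε hε1 h1 h2 hθ).2.2]

lemma radial_shell_le (hN : 1 ≤ N) {ρ τ : ℝ} (hρ0 : 0 ≤ ρ) (hρ2 : ρ ≤ 2) (hτ : 0 ≤ τ) :
    radial N {r | 0 < r ∧ r < 2 ∧ |r - ρ| < τ} ≤ ENNReal.ofReal (2 ^ N * τ) := by
  have hsub : {r | 0 < r ∧ r < 2 ∧ |r - ρ| < τ} ⊆ Set.Ico (max (ρ - τ) 0) (min (ρ + τ) 2) := by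
    rintro r ⟨h0, h2, h3⟩
    rw [abs_lt] at h3
    exact ⟨max_le (by linarith) h0.le, lt_min (by linarith) h2⟩
  have hmm : max (ρ - τ) 0 ≤ min (ρ + τ) 2 :=
    max_le (le_min (by linarith) (by linarith)) (le_min (by linarith) (by norm_num))
  refine (measure_mono hsub).trans ((radial_Ico_le hN (le_max_right _ _) hmm
    (min_le_right _ _)).trans (ENNReal.ofReal_le_ofReal ?_))
  have e : (2 : ℝ) ^ N = 2 ^ (N - 1) * 2 := by rw [← pow_succ, Nat.sub_add_cancel hN]
  rw [e, mul_assoc]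
  gcongr
  linarith [le_max_left (ρ - τ) 0, min_le_left (ρ + τ) 2]

/-- Replacing `E` by the star-shaped set with the same mass on every ray increases the energy, by
an amount controlled from below by the volume of the symmetric difference. -/
theorem energy_add_le_energy_openStar (hN : 1 ≤ N) (hp : 0 ≤ p) (hpN : p < N) (hE : MeasurableSet E)
    (hε : 0 < ε) (hε1 : ε ≤ 1 / 2) (h1 : ball 0 (1 - ε) ⊆ E) (h2 : E ⊆ ball 0 (1 + ε)) {c : ℝ}
    (hc : 0 < c)
    (hslope : ∀ A : Set (Euc N), ball 0 (1 - ε) ⊆ A → A ⊆ closedBall 0 (1 + ε) →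
      ∀ θ : Euc N, ‖θ‖ = 1 → ∀ s t : ℝ, 1 - ε ≤ s → s ≤ t → t ≤ 1 + ε →
      pot p A (t • θ) + ENNReal.ofReal (c * (t - s)) ≤ pot p A (s • θ))
    {τ : ℝ} (hτ : 0 ≤ τ) :
    energy p E + ENNReal.ofReal (c * τ) * volume (E ∆ openStar (radius E ε)) ≤
      energy p (openStar (radius E ε)) + ENNReal.ofReal (c * τ) *
        (ENNReal.ofReal (2 ^ N * τ) * (volume : Measure (Euc N)).toSphere Set.univ) := by
  set ρ := radius E ε with hρ
  have hρs : ∀ θ : Euc N, ‖θ‖ = 1 → 1 - ε ≤ ρ θ ∧ ρ θ ≤ 1 + ε ∧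
      radial N (Set.Iio (ρ θ)) = radial N {r | r • θ ∈ E} :=
    fun θ hθ => radius_spec hN hε hε1 h1 h2 hθ
  set F := openStar ρ with hF
  have hFm : MeasurableSet F := measurableSet_openStar (measurable_radius hE ε)
  have hF1 : ball 0 (1 - ε) ⊆ F := ball_subset_openStar fun x => le_max_left _ _
  have hF2 : F ⊆ closedBall 0 (1 + ε) :=
    openStar_subset_closedBall (by linarith) fun x hx => (hρs x hx).2.1
  have hEfin : volume E < ∞ := (measure_mono h2).trans_lt measure_ball_lt_top
  set w : Euc N → ℝ≥0∞ := fun x => pot p E x + pot p F x with hw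
  have hwm : Measurable w := (measurable_pot p E).add (measurable_pot p F)
  have hray : ∀ θ : Euc N, ‖θ‖ = 1 → ∀ s t : ℝ, 1 - ε ≤ s → s ≤ t → t ≤ 1 + ε →
      w (t • θ) + ENNReal.ofReal (c * (t - s)) ≤ w (s • θ) := fun θ hθ s t hs hst ht => by
    have e1 := hslope E h1 (h2.trans ball_subset_closedBall) θ hθ s t hs hst ht
    have e2 := le_self_add.trans (hslope F hF1 hF2 θ hθ s t hs hst ht)
    calc _ = (pot p E (t • θ) + ENNReal.ofReal (c * (t - s))) + pot p F (t • θ) := by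
          simp only [hw]; ring
      _ ≤ _ := add_le_add e1 e2
  have hdir : ∀ θ : sphere (0 : Euc N) 1,
      (∫⁻ r in {r | r • (θ : Euc N) ∈ E}, w (r • (θ : Euc N)) ∂radial N) +
        ENNReal.ofReal (c * τ) * radial N {r | r • (θ : Euc N) ∈ E ∆ F} ≤
      (∫⁻ r in {r | r • (θ : Euc N) ∈ F}, w (r • (θ : Euc N)) ∂radial N) +
        ENNReal.ofReal (c * τ) * ENNReal.ofReal (2 ^ N * τ) := fun θ => by
    have hθ : ‖(θ : Euc N)‖ = 1 := by simp
    obtain ⟨hl, hu, hmass⟩ := hρs θ hθ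
    have hUm : MeasurableSet {r : ℝ | r • (θ : Euc N) ∈ E} := measurable_smul_const _ hE
    have hVm : MeasurableSet {r : ℝ | r • (θ : Euc N) ∈ F} := measurable_smul_const _ hFm
    have hUV : radial N {r | r • (θ : Euc N) ∈ E} = radial N {r | r • (θ : Euc N) ∈ F} := by
      rw [hF, radial_openStar_section hθ, hmass]
    have hmemE1 : ∀ r : ℝ, 0 < r → r < 1 - ε → r • (θ : Euc N) ∈ E := fun r hr hr1 =>
      h1 (by simpa [norm_smul, hθ, abs_of_pos hr] using hr1)
    have hmemE2 : ∀ r : ℝ, 0 < r → r • (θ : Euc N) ∈ E → r < 1 + ε := fun r hr hr1 => by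
      simpa [norm_smul, hθ, abs_of_pos hr] using h2 hr1
    have hmemF : ∀ r : ℝ, 0 < r → (r • (θ : Euc N) ∈ F ↔ r < ρ θ) := fun r hr =>
      smul_mem_openStar hθ hr
    refine setLIntegral_add_le_of_slope (w := fun r => w (r • (θ : Euc N))) (ρ := ρ θ)
      (W := w (ρ θ • (θ : Euc N))) hUm hVm hUV ?_ (hwm.comp (measurable_smul_const _)) hc.le
      ?_ ?_ ?_ ?_ ?_
    · rw [hF, radial_openStar_section hθ, radial_Iio hN (by linarith)]
      exact ENNReal.ofReal_ne_top
    · filter_upwards [ae_radial_pos (N := N)] with r hr hm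
      refine hray θ hθ r (ρ θ) (not_lt.1 fun h => hm.2 (hmemE1 r hr h)) ((hmemF r hr).1 hm.1).le hu
    · filter_upwards [ae_radial_pos (N := N)] with r hr hm
      have : ρ θ ≤ r := not_lt.1 fun h => hm.2 ((hmemF r hr).2 h)
      exact hray θ hθ (ρ θ) r hl this (hmemE2 r hr hm.1).le
    · filter_upwards [ae_radial_pos (N := N)] with r hr hm
      exact ((hmemF r hr).1 hm).le
    · filter_upwards [ae_radial_pos (N := N)] with r hr hm
      exact not_lt.1 fun h => hm.2 ((hmemF r hr).2 h)
    · refine (measure_mono_ae ?_).trans (radial_shell_le hN (by linarith) (by linarith) hτ)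
      filter_upwards [ae_radial_pos (N := N)] with r hr hm
      refine ⟨hr, ?_, hm.2⟩
      rcases hm.1 with h | h
      · linarith [hmemE2 r hr h.1]
      · linarith [(hmemF r hr).1 h.1]
  have hsum : (∫⁻ x in E, w x) + ENNReal.ofReal (c * τ) * volume (E ∆ F) ≤
      (∫⁻ x in F, w x) + ENNReal.ofReal (c * τ) *
        (ENNReal.ofReal (2 ^ N * τ) * (volume : Measure (Euc N)).toSphere Set.univ) := by
    have hm : ∀ {A : Set (Euc N)}, MeasurableSet A → Measurable fun θ : sphere (0 : Euc N) 1 =>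
        radial N {r | r • (θ : Euc N) ∈ A} := fun {A} hA => by
      have h : MeasurableSet {z : sphere (0 : Euc N) 1 × ℝ | z.2 • (z.1 : Euc N) ∈ A} :=
        (by fun_prop : Measurable fun z : sphere (0 : Euc N) 1 × ℝ => z.2 • (z.1 : Euc N)) hA
      exact measurable_measure_prodMk_left h
    rw [setLIntegral_polar hN hE hwm, setLIntegral_polar hN hFm hwm,
      volume_polar hN (hE.symmDiff hFm), ← lintegral_const_mul _ (hm (hE.symmDiff hFm)),
      ← mul_assoc, ← lintegral_const, ← lintegral_add_right _ measurable_const,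
      ← lintegral_add_right _ ((hm (hE.symmDiff hFm)).const_mul _)]
    exact lintegral_mono hdir
  have e1 : ∫⁻ x in E, w x = (∫⁻ x in E, pot p F x) + energy p E := by
    rw [add_comm, energy, ← lintegral_add_left (measurable_pot p E)]
  have e2 : ∫⁻ x in F, w x = (∫⁻ x in E, pot p F x) + energy p F := by
    rw [lintegral_pot_comm, energy, ← lintegral_add_left (measurable_pot p E)]
  have hcross : ∫⁻ x in E, pot p F x ≠ ∞ := by
    have hFfin : volume F < ∞ := (measure_mono hF2).trans_lt measure_closedBall_lt_top
    refine ne_top_of_le_ne_top ?_ (lintegral_mono fun x => pot_le hp F x)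
    rw [setLIntegral_const]
    exact ENNReal.mul_ne_top (ENNReal.add_ne_top.2 ⟨(kernelMass_lt_top hN hpN).ne, hFfin.ne⟩)
      hEfin.ne
  rw [e1, e2, add_assoc, add_assoc] at hsum
  exact (ENNReal.add_le_add_iff_left hcross).1 hsum

end

/-- The closed star-shaped set with radial function `ρ`. -/
def closedStar (ρ : Euc N → ℝ) : Set (Euc N) := {x | ‖x‖ ≤ ρ (‖x‖⁻¹ • x)}

lemma measurableSet_closedStar {ρ : Euc N → ℝ} (hρ : Measurable ρ) :
    MeasurableSet (closedStar ρ) :=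
  measurableSet_le measurable_norm (hρ.comp (by fun_prop))

lemma smul_mem_closedStar {ρ : Euc N → ℝ} {θ : Euc N} (hθ : ‖θ‖ = 1) {r : ℝ} (hr : 0 < r) :
    r • θ ∈ closedStar ρ ↔ r ≤ ρ θ := by
  simp [closedStar, norm_smul, hθ, abs_of_pos hr, smul_smul, hr.ne']

lemma isNearlySpherical_preimage_closedStar (hN : 1 ≤ N) {ρ : Euc N → ℝ} (hρ : Measurable ρ)
    (hρ0 : ∀ x, 0 ≤ ρ x) {ε : ℝ} (hb : ∀ x, ‖x‖ = 1 → ρ x ∈ Set.Ioo (1 - ε) (1 + ε))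
    (hvol : volume (closedStar ρ) = volume (ball (0 : Euc N) 1)) (z : Euc N) :
    IsNearlySpherical N ε z ((· + -z) ⁻¹' closedStar ρ) := by
  have : Nonempty (Fin N) := ⟨⟨0, hN⟩⟩
  refine ⟨?_, fun x => ρ x - 1, hρ.sub_const 1, fun x hx => ?_, ?_⟩
  · rw [(measurePreserving_add_right (volume : Measure (Euc N)) (-z)).measure_preimage_emb
      (measurableEmbedding_addRight _), hvol]
  · have := hb x (by simpa using hx)
    exact ⟨by linarith [this.1], by linarith [this.2]⟩
  · ext x
    constructor
    · intro hx
      have hx' : ‖x + -z‖ ≤ ρ (‖x + -z‖⁻¹ • (x + -z)) := hx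
      rcases eq_or_ne (x + -z) 0 with h0 | h0
      · obtain ⟨θ, hθ⟩ := exists_norm_eq (Euc N) zero_le_one
        refine ⟨θ, by simpa using hθ, -1, le_rfl, by linarith [hρ0 θ], ?_⟩
        simpa [add_neg_eq_zero] using h0
      · have hn := norm_ne_zero_iff.2 h0
        refine ⟨‖x + -z‖⁻¹ • (x + -z), ?_, ‖x + -z‖ - 1, by linarith [norm_nonneg (x + -z)],
          by linarith, ?_⟩
        · simpa using norm_inv_norm_smul h0
        · rw [smul_smul, add_sub_cancel, mul_inv_cancel₀ hn, one_smul]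
          abel
    · rintro ⟨θ, hθ, s, hs1, hs2, rfl⟩
      have hθ' : ‖θ‖ = 1 := by simpa using hθ
      have e : z + (1 + s) • θ + -z = (1 + s) • θ := by abel
      change z + (1 + s) • θ + -z ∈ closedStar ρ
      rw [e]
      rcases (by linarith : 0 ≤ 1 + s).eq_or_lt with h0 | h0
      · rw [← h0, zero_smul]
        simpa [closedStar] using hρ0 0
      · exact (smul_mem_closedStar hθ' h0).2 (by linarith)

/-- The radial function obtained from `ρ` by mixing with the unit ball. -/
noncomputable def mix (N : ℕ) (η : ℝ) (ρ : Euc N → ℝ) (x : Euc N) : ℝ :=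
  ((1 - η) * ρ x ^ N + η) ^ ((N : ℝ)⁻¹)

section

variable {ρ : Euc N → ℝ} {η ε : ℝ}

lemma measurable_mix (hρ : Measurable ρ) : Measurable (mix N η ρ) :=
  (((hρ.pow_const N).const_mul _).add_const _).pow_const _

lemma mix_nonneg (hη0 : 0 < η) (hη1 : η < 1) (hρ0 : ∀ x, 0 ≤ ρ x) (x : Euc N) :
    0 ≤ mix N η ρ x := by
  have := hρ0 x
  have : 0 < 1 - η := by linarith
  unfold mix
  positivity

lemma mix_pow (hN : 1 ≤ N) (hη0 : 0 < η) (hη1 : η < 1) (hρ0 : ∀ x, 0 ≤ ρ x) (x : Euc N) :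
    mix N η ρ x ^ N = (1 - η) * ρ x ^ N + η := by
  have := hρ0 x
  have : 0 < 1 - η := by linarith
  exact Real.rpow_inv_natCast_pow (by positivity) (by omega)

lemma mix_mem_Ioo (hN : 1 ≤ N) (hη0 : 0 < η) (hη1 : η < 1) (hρ0 : ∀ x, 0 ≤ ρ x) (hε : 0 < ε)
    (hε1 : ε < 1) {x : Euc N} (hx : ρ x ∈ Set.Icc (1 - ε) (1 + ε)) :
    mix N η ρ x ∈ Set.Ioo (1 - ε) (1 + ε) := by
  have hm := mix_nonneg (N := N) hη0 hη1 hρ0 x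
  have hN0 : N ≠ 0 := by omega
  have h1 : 0 ≤ 1 - ε := by linarith
  have h2 : 0 < 1 - η := by linarith
  have l1 : (1 - ε) ^ N ≤ ρ x ^ N := pow_le_pow_left₀ h1 hx.1 N
  have l2 : ρ x ^ N ≤ (1 + ε) ^ N := pow_le_pow_left₀ (hρ0 x) hx.2 N
  have l3 : (1 - ε) ^ N < 1 := pow_lt_one₀ h1 (by linarith) hN0
  have l4 : 1 < (1 + ε) ^ N := one_lt_pow₀ (by linarith) hN0
  constructor
  · rw [← pow_lt_pow_iff_left₀ h1 hm hN0, mix_pow hN hη0 hη1 hρ0]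
    nlinarith
  · rw [← pow_lt_pow_iff_left₀ hm (by linarith) hN0, mix_pow hN hη0 hη1 hρ0]
    nlinarith

lemma radial_closedStar_section {θ : Euc N} (hθ : ‖θ‖ = 1) :
    radial N {r | r • θ ∈ closedStar ρ} = radial N (Set.Iio (ρ θ)) := by
  rw [← radial_Iic]
  refine measure_congr ?_
  filter_upwards [ae_radial_pos (N := N)] with r hr
  exact propext (smul_mem_closedStar hθ hr)

lemma volume_closedStar_mix (hN : 1 ≤ N) (hρ : Measurable ρ) (hη0 : 0 < η) (hη1 : η < 1)
    (hρ0 : ∀ x, 0 ≤ ρ x) (hvol : volume (openStar ρ) = volume (ball (0 : Euc N) 1)) :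
    volume (closedStar (mix N η ρ)) = volume (ball (0 : Euc N) 1) := by
  have hN0 : (0 : ℝ) < N := by exact_mod_cast hN
  have h1 : 0 ≤ 1 - η := by linarith
  have e : ∀ θ : sphere (0 : Euc N) 1, radial N {r | r • (θ : Euc N) ∈ closedStar (mix N η ρ)} =
      ENNReal.ofReal (1 - η) * radial N {r | r • (θ : Euc N) ∈ openStar ρ} +
        ENNReal.ofReal (η / N) := fun θ => by
    have hθ : ‖(θ : Euc N)‖ = 1 := by simp
    have h0 := hρ0 θ
    rw [radial_closedStar_section hθ, radial_openStar_section hθ,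
      radial_Iio hN (mix_nonneg hη0 hη1 hρ0 _), radial_Iio hN h0, mix_pow hN hη0 hη1 hρ0,
      ← ENNReal.ofReal_mul h1, ← ENNReal.ofReal_add (by positivity) (by positivity)]
    congr 1
    ring
  rw [volume_polar hN (measurableSet_closedStar (measurable_mix hρ)), lintegral_congr e,
    lintegral_add_right _ measurable_const, lintegral_const_mul' _ _ (by simp),
    ← volume_polar hN (measurableSet_openStar hρ), hvol, lintegral_const,
    Measure.toSphere_apply_univ,
    finrank_euclideanSpace_fin, ← mul_assoc, ← ENNReal.ofReal_natCast N,
    ← ENNReal.ofReal_mul (by positivity), div_mul_cancel₀ _ hN0.ne', ← add_mul,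
    ← ENNReal.ofReal_add h1 hη0.le, sub_add_cancel, ENNReal.ofReal_one, one_mul]

lemma volume_openStar_diff_closedStar_mix_le (hN : 1 ≤ N) (hρ : Measurable ρ) (hη0 : 0 < η)
    (hη1 : η < 1) (hρ0 : ∀ x, 0 ≤ ρ x) :
    volume (openStar ρ \ closedStar (mix N η ρ)) ≤ ENNReal.ofReal η * volume (openStar ρ) := by
  have hN0 : (0 : ℝ) < N := by exact_mod_cast hN
  rw [volume_polar hN ((measurableSet_openStar hρ).diff
    (measurableSet_closedStar (measurable_mix hρ))),
    volume_polar hN (measurableSet_openStar hρ), ← lintegral_const_mul' _ _ (by simp)]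
  refine lintegral_mono fun θ => ?_
  have hθ : ‖(θ : Euc N)‖ = 1 := by simp
  have h0 := hρ0 θ
  have hm := mix_nonneg (N := N) hη0 hη1 hρ0 θ
  have hsub : radial N {r | r • (θ : Euc N) ∈ openStar ρ \ closedStar (mix N η ρ)} ≤
      radial N (Set.Iio (ρ θ) \ Set.Iio (mix N η ρ θ)) := by
    refine measure_mono_ae ?_
    filter_upwards [ae_radial_pos (N := N)] with r hr h
    exact ⟨(smul_mem_openStar hθ hr).1 h.1,
      fun h' => h.2 ((smul_mem_closedStar hθ hr).2 (le_of_lt h'))⟩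
  refine hsub.trans ?_
  rw [radial_openStar_section hθ]
  rcases le_total (ρ θ) (mix N η ρ θ) with h | h
  · rw [Set.sdiff_eq_empty.2 (Set.Iio_subset_Iio h)]
    simp
  · rw [measure_sdiff (Set.Iio_subset_Iio h) measurableSet_Iio.nullMeasurableSet
      (by simp [radial_Iio hN hm]), radial_Iio hN h0, radial_Iio hN hm,
      ← ENNReal.ofReal_sub _ (by positivity), ← ENNReal.ofReal_mul hη0.le,
      mix_pow hN hη0 hη1 hρ0]
    refine ENNReal.ofReal_le_ofReal ?_
    rw [← sub_div, ← mul_div_assoc]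
    gcongr
    linarith

end

/-- Sets of equal finite measure have differences of equal measure. -/
lemma volume_symmDiff_eq {A C : Set (Euc N)} (hA : MeasurableSet A) (hC : MeasurableSet C)
    (h : volume A = volume C) (hfin : volume A ≠ ∞) :
    volume (A ∆ C) = 2 * volume (A \ C) := by
  have e1 := measure_inter_add_sdiff (μ := volume) A hC
  have e2 := measure_inter_add_sdiff (μ := volume) C hA
  rw [Set.inter_comm, ← h, ← e1] at e2
  have e3 := (ENNReal.add_right_inj (ne_top_of_le_ne_top hfin
    (measure_mono Set.inter_subset_left))).1 e2
  rw [measure_symmDiff_eq hA.nullMeasurableSet hC.nullMeasurableSet, e3, two_mul]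

lemma asymmetry_le (E : Set (Euc N)) (x : Euc N) :
    asymmetry N E ≤ (volume (ball x 1 ∆ E)).toReal :=
  ciInf_le ⟨0, by rintro _ ⟨y, rfl⟩; exact ENNReal.toReal_nonneg⟩ x

lemma toSphere_univ_pos (hN : 1 ≤ N) :
    0 < ((volume : Measure (Euc N)).toSphere Set.univ).toReal := by
  have : (N : ℝ≥0∞) ≠ 0 := by simp; omega
  rw [Measure.toSphere_apply_univ, finrank_euclideanSpace_fin]
  exact ENNReal.toReal_pos (mul_ne_zero this (measure_ball_pos _ _ one_pos).ne')
    (ENNReal.mul_ne_top (by simp) measure_ball_lt_top.ne)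

lemma deficit_eq (hN : 1 ≤ N) {α : ℝ} (hα₀ : 0 < α) (hα : α ≤ N) {A : Set (Euc N)}
    (hA : volume A < ∞) :
    deficit N α A = (energy (N - α) (ball (0 : Euc N) 1)).toReal - (energy (N - α) A).toReal := by
  rw [deficit, rieszEnergy_eq hN hα₀ hα measure_ball_lt_top, rieszEnergy_eq hN hα₀ hα hA]

lemma deficit_pos (hN : 1 ≤ N) {α : ℝ} (hα₀ : 0 < α) (hα : α < N) {A : Set (Euc N)}
    (hA : MeasurableSet A) (hvol : volume A = volume (ball (0 : Euc N) 1)) {R : ℝ}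
    (hAR : A ⊆ ball 0 R) (hδ : 0 < asymmetry N A) : 0 < deficit N α A := by
  have hfin : volume A < ∞ := hvol ▸ measure_ball_lt_top
  by_contra! h
  rw [deficit_eq hN hα₀ hα.le hfin, sub_nonpos, ENNReal.toReal_le_toReal
    (energy_lt_top hN (by linarith) (by linarith) measure_ball_lt_top).ne
    (energy_lt_top hN (by linarith) (by linarith) hfin).ne] at h
  obtain ⟨w, hw⟩ := exists_volume_symmDiff_eq_zero hN (by linarith) (by linarith) hA hvol hAR h
  have := asymmetry_le A w
  rw [hw, ENNReal.toReal_zero] at this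
  linarith

section

variable {E : Set (Euc N)} {ε c : ℝ}

/-- The energy gained by passing from `E` to the star-shaped set with the same mass on every ray
controls the square of the volume of the symmetric difference. -/
lemma sq_volume_symmDiff_openStar_le (hN : 1 ≤ N) (hp : 0 ≤ p) (hpN : p < N) (hE : MeasurableSet E)
    (hε : 0 < ε) (hε1 : ε ≤ 1 / 2) (h1 : ball 0 (1 - ε) ⊆ E) (h2 : E ⊆ ball 0 (1 + ε))
    (hc : 0 < c)
    (hslope : ∀ A : Set (Euc N), ball 0 (1 - ε) ⊆ A → A ⊆ closedBall 0 (1 + ε) →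
      ∀ θ : Euc N, ‖θ‖ = 1 → ∀ s t : ℝ, 1 - ε ≤ s → s ≤ t → t ≤ 1 + ε →
      pot p A (t • θ) + ENNReal.ofReal (c * (t - s)) ≤ pot p A (s • θ)) :
    c * (volume (E ∆ openStar (radius E ε))).toReal ^ 2 ≤
      4 * (2 ^ N * ((volume : Measure (Euc N)).toSphere Set.univ).toReal) *
        ((energy p (openStar (radius E ε))).toReal - (energy p E).toReal) := by
  have hEfin : volume E < ∞ := (measure_mono h2).trans_lt measure_ball_lt_top
  have hvol := volume_openStar_radius hN hE hε hε1 h1 h2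
  set F := openStar (radius E ε) with hF
  set σ := (volume : Measure (Euc N)).toSphere Set.univ with hσ
  have hσ0 : 0 < σ.toReal := toSphere_univ_pos hN
  have hσfin : σ ≠ ∞ := measure_ne_top _ _
  have hFfin : volume F < ∞ := hvol ▸ hEfin
  have hMfin : volume (E ∆ F) ≠ ∞ :=
    ne_top_of_le_ne_top (ENNReal.add_ne_top.2 ⟨hEfin.ne, hFfin.ne⟩)
      ((measure_mono Set.symmDiff_subset_union).trans (measure_union_le _ _))
  have hEe := (energy_lt_top hN hp hpN hEfin).ne
  have hFe := (energy_lt_top hN hp hpN hFfin).ne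
  set M := (volume (E ∆ F)).toReal with hM
  have hM0 : 0 ≤ M := ENNReal.toReal_nonneg
  set κ := 2 ^ N * σ.toReal with hκ
  have hκ0 : 0 < κ := by positivity
  have hτ : 0 ≤ M / (2 * κ) := by positivity
  have key := energy_add_le_energy_openStar hN hp hpN hE hε hε1 h1 h2 hc hslope hτ
  rw [← hF, ← hσ, ← ENNReal.ofReal_toReal hMfin, ← ENNReal.ofReal_toReal hEe,
    ← ENNReal.ofReal_toReal hFe, ← ENNReal.ofReal_toReal hσfin, ← hM,
    ← ENNReal.ofReal_mul (by positivity), ← ENNReal.ofReal_mul (by positivity),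
    ← ENNReal.ofReal_mul (by positivity), ← ENNReal.ofReal_add (by positivity) (by positivity),
    ← ENNReal.ofReal_add (by positivity) (by positivity),
    ENNReal.ofReal_le_ofReal_iff (by positivity)] at key
  have e1 : 2 ^ N * (M / (2 * κ)) * σ.toReal = M / 2 := by
    have : 2 ^ N * (M / (2 * κ)) * σ.toReal = κ * (M / (2 * κ)) := by rw [hκ]; ring
    rw [this]
    field_simp
  rw [e1] at key
  have e2 : c * M ^ 2 = 4 * κ * (c * (M / (2 * κ)) * M - c * (M / (2 * κ)) * (M / 2)) := by
    field_simp
    ring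
  rw [e2]
  exact mul_le_mul_of_nonneg_left (by linarith) (by positivity)

end

/-- A star-shaped set trapped between two balls is approximated by nearly spherical sets, with
control of the energy. -/
lemma exists_isNearlySpherical_near_openStar (hN : 1 ≤ N) (hp : 0 ≤ p) (hpN : p < N) {ρ : Euc N → ℝ}
    (hρ : Measurable ρ) (hρ0 : ∀ x, 0 ≤ ρ x) {ε : ℝ} (hε : 0 < ε) (hε1 : ε < 1)
    (hb : ∀ x, ‖x‖ = 1 → ρ x ∈ Set.Icc (1 - ε) (1 + ε))
    (hvol : volume (openStar ρ) = volume (ball (0 : Euc N) 1)) (z : Euc N) {η : ℝ} (hη0 : 0 < η)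
    (hη1 : η < 1) :
    ∃ A : Set (Euc N), IsNearlySpherical N ε z A ∧
      (energy p (openStar ρ)).toReal ≤ (energy p A).toReal +
        2 * (kernelMass N p + volume (ball (0 : Euc N) 1)).toReal *
          (η * (volume (ball (0 : Euc N) 1)).toReal) ∧
      (volume (openStar ρ ∆ ball 0 1)).toReal ≤
        (volume (A ∆ ball z 1)).toReal + 2 * (η * (volume (ball (0 : Euc N) 1)).toReal) := by
  set ω := volume (ball (0 : Euc N) 1) with hω
  have hωfin : ω ≠ ∞ := measure_ball_lt_top.ne
  set F := openStar ρ with hF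
  set G := closedStar (mix N η ρ) with hG
  have hGvol : volume G = ω := volume_closedStar_mix hN hρ hη0 hη1 hρ0 hvol
  have hdiff : volume (F \ G) ≤ ENNReal.ofReal η * ω :=
    hvol ▸ volume_openStar_diff_closedStar_mix_le hN hρ hη0 hη1 hρ0
  have hηω : (ENNReal.ofReal η * ω).toReal = η * ω.toReal := by
    rw [ENNReal.toReal_mul, ENNReal.toReal_ofReal hη0.le]
  have hηfin : ENNReal.ofReal η * ω ≠ ∞ := ENNReal.mul_ne_top (by simp) hωfin
  have hK : kernelMass N p + ω ≠ ∞ := ENNReal.add_ne_top.2 ⟨(kernelMass_lt_top hN hpN).ne, hωfin⟩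
  have hGe : energy p G ≠ ∞ :=
    (energy_lt_top hN hp hpN (by rw [hGvol]; exact hωfin.lt_top)).ne
  refine ⟨(· + -z) ⁻¹' G, isNearlySpherical_preimage_closedStar hN (measurable_mix hρ)
    (mix_nonneg hη0 hη1 hρ0) (fun x hx => mix_mem_Ioo hN hη0 hη1 hρ0 hε hε1 (hb x hx)) hGvol z,
    ?_, ?_⟩
  · have h := energy_le_add hp F G
    rw [hvol, hGvol, ← two_mul] at h
    have h' := h.trans (add_le_add_right (mul_le_mul_right hdiff _) _)
    have hfin : 2 * (kernelMass N p + ω) * (ENNReal.ofReal η * ω) ≠ ∞ :=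
      ENNReal.mul_ne_top (ENNReal.mul_ne_top (by simp) hK) hηfin
    have h3 := ENNReal.toReal_mono (ENNReal.add_ne_top.2 ⟨hGe, hfin⟩) h'
    rw [ENNReal.toReal_add hGe hfin, ENNReal.toReal_mul, ENNReal.toReal_mul, hηω] at h3
    simpa [energy_preimage_add] using h3
  · have hpre : ((· + -z) ⁻¹' G) ∆ ball z 1 = (· + -z) ⁻¹' (G ∆ ball 0 1) := by
      rw [Set.preimage_symmDiff]
      congr 1
      ext x
      simp [dist_eq_norm, sub_eq_add_neg]
    rw [hpre, measure_preimage_add_right]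
    have hFG : volume (F ∆ G) ≤ 2 * (ENNReal.ofReal η * ω) := by
      rw [volume_symmDiff_eq (measurableSet_openStar hρ)
        (measurableSet_closedStar (measurable_mix hρ))
        (hvol.trans hGvol.symm) (hvol ▸ hωfin)]
      gcongr
    have hGB : volume (G ∆ ball 0 1) ≠ ∞ :=
      ne_top_of_le_ne_top (ENNReal.add_ne_top.2 ⟨hGvol ▸ hωfin, hωfin⟩)
        ((measure_mono Set.symmDiff_subset_union).trans (measure_union_le _ _))
    have h2 : 2 * (ENNReal.ofReal η * ω) ≠ ∞ := ENNReal.mul_ne_top (by simp) hηfin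
    have h := (measure_symmDiff_le F G (ball (0 : Euc N) 1)).trans
      (add_le_add_left hFG (volume (G ∆ ball 0 1)))
    have h3 := ENNReal.toReal_mono (ENNReal.add_ne_top.2 ⟨h2, hGB⟩) h
    rw [ENNReal.toReal_add h2 hGB, ENNReal.toReal_mul, hηω] at h3
    rw [add_comm]
    simpa using h3

end RieszStability

open RieszStability

theorem nearly_spherical_from_uniformly_close (N : ℕ) (hN : 2 ≤ N) (α : ℝ) (hα₁ : 1 < α)
    (hα₂ : α < N) :
    ∃ ε₁ : ℝ, 0 < ε₁ ∧ ε₁ < 1 ∧ ∃ C : ℝ, 0 < C ∧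
      ∀ ε : ℝ, 0 < ε → ε < ε₁ →
      ∀ E' : Set (EuclideanSpace ℝ (Fin N)), MeasurableSet E' →
        volume E' = volume (ball (0 : EuclideanSpace ℝ (Fin N)) 1) →
        ∀ z : EuclideanSpace ℝ (Fin N), ball z (1 - ε) ⊆ E' → E' ⊆ ball z (1 + ε) →
        (asymmetry N E' ≤ C * Real.sqrt (deficit N α E')) ∨
        (∃ Ez : Set (EuclideanSpace ℝ (Fin N)), IsNearlySpherical N ε z Ez ∧
          deficit N α Ez ≤ 2 * deficit N α E' ∧
          (volume (Ez ∆ ball z 1)).toReal ≥ asymmetry N E' / 6) := by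
  have hN1 : 1 ≤ N := by omega
  have hp : 0 < (N : ℝ) - α := by linarith
  have hpN : (N : ℝ) - α < N := by linarith
  obtain ⟨ε₀, hε₀, hε₀h, c, hc, hslope⟩ := exists_pot_slope hp (by linarith : (N : ℝ) - α + 1 < N)
  set κ := 2 ^ N * ((volume : Measure (Euc N)).toSphere Set.univ).toReal with hκ
  have hκ0 : 0 < κ := mul_pos (by positivity) (toSphere_univ_pos hN1)
  refine ⟨ε₀, hε₀, by linarith, √(16 * κ / c), by positivity, ?_⟩
  intro ε hε hεε₀ E' hE'm hvol z h1 h2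
  set ω := volume (ball (0 : Euc N) 1) with hω
  have hω0 : 0 < ω.toReal :=
    ENNReal.toReal_pos (measure_ball_pos _ _ one_pos).ne' measure_ball_lt_top.ne
  rcases le_or_gt (asymmetry N E') 0 with hδ | hδ
  · exact .inl (hδ.trans (by positivity))
  have hD : 0 < deficit N α E' := deficit_pos hN1 (by linarith) hα₂ hE'm hvol
    (h2.trans (ball_subset_ball' (by rw [dist_zero_right] : 1 + ε + dist z 0 ≤ 1 + ε + ‖z‖))) hδ
  have hpre : ∀ r : ℝ, (· + z) ⁻¹' ball z r = ball (0 : Euc N) r := fun r => by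
    ext x
    simp [dist_eq_norm]
  set E := (· + z) ⁻¹' E' with hE
  have hEm : MeasurableSet E := measurable_add_const z hE'm
  have hEvol : volume E = ω := by rw [hE, measure_preimage_add_right, hvol]
  have hE1 : ball 0 (1 - ε) ⊆ E := hpre (1 - ε) ▸ Set.preimage_mono h1
  have hE2 : E ⊆ ball 0 (1 + ε) := hpre (1 + ε) ▸ Set.preimage_mono h2
  have hDE : deficit N α E' = (energy (N - α) (ball (0 : Euc N) 1)).toReal -
      (energy (N - α) E).toReal := by
    rw [deficit_eq hN1 (by linarith) hα₂.le (hvol ▸ measure_ball_lt_top), hE, energy_preimage_add]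
  have hspec : ∀ x : Euc N, ‖x‖ = 1 → radius E ε x ∈ Set.Icc (1 - ε) (1 + ε) := fun x hx =>
    ⟨(radius_spec hN1 hε (by linarith) hE1 hE2 hx).1,
      (radius_spec hN1 hε (by linarith) hE1 hE2 hx).2.1⟩
  have hFvol : volume (openStar (radius E ε)) = ω :=
    (volume_openStar_radius hN1 hEm hε (by linarith) hE1 hE2).trans hEvol
  have hFm := measurableSet_openStar (measurable_radius hEm ε)
  have hFR : openStar (radius E ε) ⊆ ball 0 2 :=
    (openStar_subset_closedBall (by linarith) fun x hx => (hspec x hx).2).trans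
      (closedBall_subset_ball (by linarith))
  have hsq := sq_volume_symmDiff_openStar_le hN1 hp.le hpN hEm hε (by linarith) hE1 hE2 hc
    (hslope ε hε hεε₀)
  have hFB := ENNReal.toReal_mono (energy_lt_top hN1 hp.le hpN measure_ball_lt_top).ne
    (energy_le_energy_ball hN1 hp.le hpN hFm hFvol hFR)
  have hδF : asymmetry N E' ≤ (volume (E ∆ openStar (radius E ε))).toReal +
      (volume (openStar (radius E ε) ∆ ball 0 1)).toReal := by
    have hfin : ∀ {A C : Set (Euc N)}, volume A = ω → volume C = ω → volume (A ∆ C) ≠ ⊤ :=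
      fun hA hC => ne_top_of_le_ne_top (ENNReal.add_ne_top.2
        ⟨hA ▸ measure_ball_lt_top.ne, hC ▸ measure_ball_lt_top.ne⟩)
        ((measure_mono Set.symmDiff_subset_union).trans (measure_union_le _ _))
    have e : volume (ball z 1 ∆ E') = volume (E ∆ ball 0 1) := by
      rw [← measure_preimage_add_right volume z, Set.preimage_symmDiff, hpre, symmDiff_comm]
    rw [← ENNReal.toReal_add (hfin hEvol hFvol) (hfin hFvol rfl)]
    exact (asymmetry_le E' z).trans (e ▸ ENNReal.toReal_mono
      (ENNReal.add_ne_top.2 ⟨hfin hEvol hFvol, hfin hFvol rfl⟩) (measure_symmDiff_le _ _ _))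
  set M := (volume (E ∆ openStar (radius E ε))).toReal with hM
  rw [← hκ] at hsq
  have hEF : (energy (N - α) E).toReal ≤ (energy (N - α) (openStar (radius E ε))).toReal := by
    have : 0 ≤ c * M ^ 2 := by positivity
    nlinarith
  rcases le_or_gt (asymmetry N E') (2 * M) with hle | hgt
  · left
    rw [← Real.sqrt_mul (by positivity)]
    refine Real.le_sqrt_of_sq_le ?_
    rw [div_mul_eq_mul_div, le_div_iff₀ hc]
    have : asymmetry N E' ^ 2 ≤ (2 * M) ^ 2 := pow_le_pow_left₀ hδ.le hle 2
    nlinarith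
  · right
    set K := 2 * (kernelMass N (N - α) + ω).toReal with hK
    have hK0 : 0 < K := by
      have : ω.toReal ≤ (kernelMass N (N - α) + ω).toReal := ENNReal.toReal_mono
        (ENNReal.add_ne_top.2 ⟨(kernelMass_lt_top hN1 hpN).ne, measure_ball_lt_top.ne⟩) le_add_self
      linarith
    set η := min (1 / 2) (min (deficit N α E' / (K * ω.toReal)) (asymmetry N E' / (6 * ω.toReal)))
      with hη
    have hη0 : 0 < η := lt_min (by norm_num) (lt_min (by positivity) (by positivity))
    have hη1 : η ≤ 1 / 2 := min_le_left _ _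
    have hη2 : η * (K * ω.toReal) ≤ deficit N α E' :=
      (le_div_iff₀ (by positivity)).1 ((min_le_right _ _).trans (min_le_left _ _))
    have hη3 : η * (6 * ω.toReal) ≤ asymmetry N E' :=
      (le_div_iff₀ (by positivity)).1 ((min_le_right _ _).trans (min_le_right _ _))
    obtain ⟨A, hA, hAe, hAv⟩ := exists_isNearlySpherical_near_openStar hN1 hp.le hpN
      (measurable_radius hEm ε) (fun x => (by linarith : 0 ≤ 1 - ε).trans (le_max_left _ _)) hε
      (by linarith) hspec hFvol z hη0 (by linarith)
    refine ⟨A, hA, ?_, ?_⟩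
    · rw [deficit_eq hN1 (by linarith) hα₂.le (hA.1 ▸ measure_ball_lt_top)]
      rw [← hω, ← hK] at hAe
      linarith
    · rw [← hω] at hAv
      linarith
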